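/- arXiv:2512.06588 — 7 statements merged into one kernel-verified Lean document; each statement's English description precedes it below -/
import Mathlib

section
/- Let E be a finite field of odd characteristic and let k ≥ 1. Let χ be a nontrivial multiplicative character of E, let ψ be an additive character of E, and let X be a k×k matrix over E with det X = 0. Then ∑_{h ∈ GL_k(E)} χ(det h) · ψ(tr(X·h)) = 0. -/
open scoped MatrixGroups

/-- A singular matrix over a field is fixed by right multiplication by invertible matrices of
arbitrary nonzero determinant. -/
theorem Matrix.exists_GL_mul_eq_self_of_det_eq_zero {n K : Type*} [Fintype n] [DecidableEq n]
    [Field K] {X : Matrix n n K} (hX : X.det = 0) (a : Kˣ) :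
    ∃ u : GL n K, X * (u : Matrix n n K) = X ∧ (u : Matrix n n K).det = a := by
  obtain ⟨v, hv, hXv⟩ := Matrix.exists_mulVec_eq_zero_iff.mpr hX
  obtain ⟨i, hi⟩ := Function.ne_iff.mp hv
  let w : n → K := Pi.single i (((a : K) - 1) * (v i)⁻¹)
  let U : Matrix n n K := 1 + Matrix.replicateCol Unit v * Matrix.replicateRow Unit w
  have hdet : U.det = a := by
    rw [Matrix.det_one_add_replicateCol_mul_replicateRow, single_dotProduct,
      inv_mul_cancel_right₀ hi, add_sub_cancel]
  refine ⟨Matrix.GeneralLinearGroup.mkOfDetNeZero U (hdet ▸ a.ne_zero), ?_, hdet⟩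
  change X * U = X
  rw [mul_add, mul_one, ← Matrix.mul_assoc, ← Matrix.replicateCol_mulVec, hXv,
    Matrix.replicateCol_zero, Matrix.zero_mul, add_zero]

/-- Let `E` be a finite field of odd characteristic and `k ≥ 1`. For a
nontrivial multiplicative character `χ` of `E`, an additive character `ψ` of `E`, and a
singular `k × k` matrix `X` over `E`, the sum `∑_{h ∈ GL_k(E)} χ(det h) ψ(tr (X h))`
vanishes. -/
theorem jacobi_sum_singular_vanishes
    (E : Type*) [Field E] [Fintype E] [DecidableEq E] (hE : ringChar E ≠ 2)
    (k : ℕ) (hk : 1 ≤ k)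
    (χ : MulChar E ℂ) (hχ : χ ≠ 1) (ψ : AddChar E ℂ)
    (X : Matrix (Fin k) (Fin k) E) (hX : X.det = 0) :
    ∑ h : GL (Fin k) E,
      χ ((h : Matrix (Fin k) (Fin k) E).det) *
        ψ ((X * (h : Matrix (Fin k) (Fin k) E)).trace) = 0 := by
  obtain ⟨a, ha⟩ := MulChar.ne_one_iff.mp hχ
  obtain ⟨u, hXu, hu⟩ := Matrix.exists_GL_mul_eq_self_of_det_eq_zero hX a
  refine eq_zero_of_mul_eq_self_left ha ?_
  rw [Finset.mul_sum, ← Equiv.sum_comp (Equiv.mulLeft u)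
    (fun h : GL (Fin k) E => χ ((h : Matrix (Fin k) (Fin k) E).det) *
      ψ ((X * (h : Matrix (Fin k) (Fin k) E)).trace))]
  refine Finset.sum_congr rfl fun h _ => ?_
  rw [Equiv.coe_mulLeft, Units.val_mul, Matrix.det_mul, hu, map_mul, ← Matrix.mul_assoc, hXu,
    mul_assoc]
end

section
/- Let E be a finite field of odd characteristic, k ≥ 1, χ a nontrivial multiplicative character of E, and ψ a nontrivial additive character of E. Then for every g ∈ GL_k(E), the quantity defined as χ(det(I + g)) when det(I + g) ≠ 0 and as 0 otherwise is equal to χ(−1)^k · |E|^{−k²} · (∑_{h ∈ GL_k(E)} χ(det h) ψ(tr h)) · (∑_{y ∈ GL_k(E)} χ(det y)⁻¹ ψ(tr y) ψ(tr(y·g))). -/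
open scoped MatrixGroups

open Matrix

section MatrixGaussSum

variable {E n : Type*} [Field E] [Fintype n] [DecidableEq n]

/-- A sum over `GL n E` of a function vanishing at singular matrices is the sum over all
matrices. -/
lemma sum_generalLinearGroup_eq_sum_matrix [Fintype E] [DecidableEq E] {M : Type*}
    [AddCommMonoid M] (f : Matrix n n E → M) (hf : ∀ A, A.det = 0 → f A = 0) :
    ∑ h : GL n E, f h = ∑ A : Matrix n n E, f A := by
  refine Fintype.sum_of_injective (fun h : GL n E => (h : Matrix n n E)) Units.val_injective _ _
    (fun A hA => hf A ?_) (fun _ => rfl)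
  by_contra hdet
  exact hA ⟨GeneralLinearGroup.mkOfDetNeZero A hdet, rfl⟩

/-- A singular matrix is fixed under left multiplication by matrices of any determinant. -/
lemma exists_det_eq_mul_eq_self {A : Matrix n n E} (hA : A.det = 0) (d : E) :
    ∃ h : Matrix n n E, h.det = d ∧ h * A = A := by
  obtain ⟨v, hv, hvA⟩ := exists_vecMul_eq_zero_iff.mpr hA
  obtain ⟨i, hi⟩ := Function.ne_iff.mp hv
  refine ⟨1 + vecMulVec (Pi.single i ((d - 1) / v i)) v, ?_, ?_⟩
  · have hi' : v i ≠ 0 := hi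
    rw [vecMulVec_eq Unit, det_one_add_replicateCol_mul_replicateRow, dotProduct_single]
    field_simp
    ring
  · rw [add_mul, one_mul, vecMulVec_mul, hvA, vecMulVec_zero, add_zero]

variable [Fintype E]

open scoped Classical in
/-- The Fourier transform of `χ⁻¹ ∘ det` on the space of matrices. -/
noncomputable def invDetTransform (n : Type*) [Fintype n] [DecidableEq n] (χ : MulChar E ℂ)
    (ψ : AddChar E ℂ) (A : Matrix n n E) : ℂ :=
  ∑ y : Matrix n n E, (χ y.det)⁻¹ * ψ (y * A).trace

lemma invDetTransform_mul (χ : MulChar E ℂ) (ψ : AddChar E ℂ) {h : Matrix n n E}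
    (hh : h.det ≠ 0) (A : Matrix n n E) :
    invDetTransform n χ ψ (h * A) = χ h.det * invDetTransform n χ ψ A := by
  classical
  have hχ : χ h.det ≠ 0 := (hh.isUnit.map χ).ne_zero
  have hu : IsUnit h := (isUnit_iff_isUnit_det h).mpr hh.isUnit
  unfold invDetTransform
  rw [Finset.mul_sum]
  refine Fintype.sum_equiv hu.unit.mulRight _ _ fun y => ?_
  simp only [Units.mulRight_apply, IsUnit.unit_spec, det_mul, map_mul, mul_inv, Matrix.mul_assoc]
  field_simp

lemma invDetTransform_eq {χ : MulChar E ℂ} (hχ : χ ≠ 1) (ψ : AddChar E ℂ) (A : Matrix n n E) :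
    invDetTransform n χ ψ A = χ A.det * invDetTransform n χ ψ 1 := by
  by_cases hA : A.det = 0
  · obtain ⟨d, hd⟩ := MulChar.ne_one_iff.mp hχ
    obtain ⟨h, hdet, hhA⟩ := exists_det_eq_mul_eq_self hA (d : E)
    have key := invDetTransform_mul χ ψ (hdet ▸ d.ne_zero) A
    rw [hhA, hdet] at key
    rw [hA, MulChar.map_zero, zero_mul]
    by_contra hne
    exact hd (mul_right_cancel₀ hne (by rw [one_mul, ← key]))
  · simpa using invDetTransform_mul χ ψ hA 1

lemma sum_addChar_trace_mul [DecidableEq E] {ψ : AddChar E ℂ} (hψ : ψ ≠ 1) (B : Matrix n n E) :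
    ∑ A : Matrix n n E, ψ (B * A).trace =
      if B = 0 then (Fintype.card E : ℂ) ^ (Fintype.card n ^ 2) else 0 := by
  split_ifs with hB
  · have hcard : Fintype.card (Matrix n n E) = Fintype.card E ^ (Fintype.card n ^ 2) := by
      rw [Fintype.card_congr (Matrix.of (m := n) (n := n) (α := E)).symm]
      simp [← pow_mul, sq]
    simp [hB, hcard]
  · let φ : AddChar (Matrix n n E) ℂ :=
      ψ.compAddMonoidHom ((traceAddMonoidHom n E).comp (AddMonoidHom.mulLeft B))
    refine AddChar.sum_eq_zero_of_ne_one (ψ := φ) fun hφ => ?_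
    obtain ⟨c, hc⟩ := AddChar.ne_one_iff.mp hψ
    obtain ⟨i, j, hij⟩ : ∃ i j, B i j ≠ 0 := by
      by_contra! h
      exact hB (Matrix.ext h)
    have := DFunLike.congr_fun hφ (single j i ((B i j)⁻¹ * c))
    apply hc
    simpa [φ, trace_mul_single, hij] using this

/-- The product of the matrix Gauss sums attached to `χ` and `χ⁻¹`. -/
lemma matrixGaussSum_mul_invDetTransform_one [DecidableEq E] {χ : MulChar E ℂ} (hχ : χ ≠ 1)
    {ψ : AddChar E ℂ} (hψ : ψ ≠ 1) :
    χ (-1) ^ Fintype.card n * (∑ A : Matrix n n E, χ A.det * ψ A.trace) *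
      invDetTransform n χ ψ 1 = (Fintype.card E : ℂ) ^ (Fintype.card n ^ 2) := by
  calc
    _ = ∑ A : Matrix n n E, invDetTransform n χ ψ A * ψ (-A).trace := by
      rw [Finset.mul_sum, Finset.sum_mul]
      refine Fintype.sum_equiv (Equiv.neg _) _ _ fun A => ?_
      rw [Equiv.neg_apply, invDetTransform_eq hχ ψ (-A), det_neg, map_mul, map_pow, neg_neg]
      ring
    _ = ∑ y : Matrix n n E, (χ y.det)⁻¹ * ∑ A : Matrix n n E, ψ ((y - 1) * A).trace := by
      simp only [invDetTransform, Finset.sum_mul, Finset.mul_sum]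
      rw [Finset.sum_comm]
      refine Finset.sum_congr (by congr!) fun y _ => Finset.sum_congr (by congr!) fun A _ => ?_
      rw [mul_assoc, ← AddChar.map_add_eq_mul, ← trace_add, sub_mul, one_mul, sub_eq_add_neg]
    _ = _ := by
      simp [sum_addChar_trace_mul hψ, sub_eq_zero]

end MatrixGaussSum

/-- For a finite field `E` of odd characteristic, `k ≥ 1`, a nontrivial
multiplicative character `χ` and a nontrivial additive character `ψ` of `E`, and
`g ∈ GL_k(E)`, the quantity `χ(det(I + g))` (interpreted as `0` when `det(I + g) = 0`)
equals `χ(-1)^k · |E|^{-k²} · (∑_h χ(det h) ψ(tr h)) ·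
(∑_y χ(det y)⁻¹ ψ(tr y) ψ(tr (y g)))`. -/
theorem jacobi_kernel_as_fourier_transform
    (E : Type*) [Field E] [Fintype E] [DecidableEq E] (hE : ringChar E ≠ 2)
    (k : ℕ) (hk : 1 ≤ k)
    (χ : MulChar E ℂ) (hχ : χ ≠ 1) (ψ : AddChar E ℂ) (hψ : ψ ≠ 1)
    (g : GL (Fin k) E) :
    (if (1 + (g : Matrix (Fin k) (Fin k) E)).det ≠ 0
      then χ ((1 + (g : Matrix (Fin k) (Fin k) E)).det) else 0) =
    χ (-1) ^ k * (Fintype.card E : ℂ) ^ (-(k ^ 2 : ℤ)) *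
      (∑ h : GL (Fin k) E,
        χ ((h : Matrix (Fin k) (Fin k) E).det) *
          ψ ((h : Matrix (Fin k) (Fin k) E).trace)) *
      (∑ y : GL (Fin k) E,
        (χ ((y : Matrix (Fin k) (Fin k) E).det))⁻¹ *
          ψ ((y : Matrix (Fin k) (Fin k) E).trace) *
          ψ (((y : Matrix (Fin k) (Fin k) E) *
            (g : Matrix (Fin k) (Fin k) E)).trace)) := by
  have hy : ∀ y : Matrix (Fin k) (Fin k) E,
      (χ y.det)⁻¹ * ψ y.trace * ψ (y * (g : Matrix (Fin k) (Fin k) E)).trace =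
        (χ y.det)⁻¹ * ψ (y * (1 + (g : Matrix (Fin k) (Fin k) E))).trace := fun y => by
    rw [mul_assoc, ← AddChar.map_add_eq_mul, ← trace_add, mul_add, mul_one]
  have hF : ∑ y : Matrix (Fin k) (Fin k) E,
      (χ y.det)⁻¹ * ψ (y * (1 + (g : Matrix (Fin k) (Fin k) E))).trace =
        χ (1 + (g : Matrix (Fin k) (Fin k) E)).det * invDetTransform (Fin k) χ ψ 1 := by
    rw [← invDetTransform_eq hχ ψ, invDetTransform]
  have hG := matrixGaussSum_mul_invDetTransform_one (n := Fin k) hχ hψ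
  rw [sum_generalLinearGroup_eq_sum_matrix (fun A => χ A.det * ψ A.trace)
      (fun A hA => by simp [hA, MulChar.map_zero]),
    sum_generalLinearGroup_eq_sum_matrix (fun y : Matrix (Fin k) (Fin k) E =>
      (χ y.det)⁻¹ * ψ y.trace * ψ (y * (g : Matrix (Fin k) (Fin k) E)).trace)
      (fun A hA => by simp [hA, MulChar.map_zero])]
  simp only [hy, hF]
  rw [Fintype.card_fin] at hG
  have hχ0 : (if (1 + (g : Matrix (Fin k) (Fin k) E)).det ≠ 0
      then χ (1 + (g : Matrix (Fin k) (Fin k) E)).det else 0) =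
        χ (1 + (g : Matrix (Fin k) (Fin k) E)).det := by
    split_ifs with h
    · rfl
    · rw [not_not.mp h, MulChar.map_zero]
  rw [hχ0, _root_.zpow_neg, ← Nat.cast_pow, zpow_natCast]
  field_simp
  rw [← hG]
  ring
end

section
/- Let E be a finite field of odd characteristic, k ≥ 1, χ a nontrivial multiplicative character of E, and ψ a nontrivial additive character of E. Let π be a representation of GL_k(E) on a finite-dimensional complex vector space V. Then the following identity of ℂ-linear endomorphisms of V holds: ∑_{g ∈ GL_k(E), det(I+g) ≠ 0} χ(det(I + g)) · π(g) = χ(−1)^k · |E|^{−k²} · (∑_{h ∈ GL_k(E)} χ(det h) ψ(tr h)) · (∑_{y ∈ GL_k(E)} χ(det y)⁻¹ ψ(tr y) π(y⁻¹)) ∘ (∑_{x ∈ GL_k(E)} ψ(tr x) π(x)). -/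
open scoped MatrixGroups

namespace MatrixGaussSum

variable {n E : Type*} [Fintype n] [DecidableEq n] [Field E]

/-- A singular square matrix is fixed under left multiplication by invertible matrices of any
prescribed nonzero determinant. -/
lemma exists_mul_eq_self_of_det_eq_zero {A : Matrix n n E} (hA : A.det = 0) {t : E}
    (ht : t ≠ 0) : ∃ u : GL n E, (u : Matrix n n E) * A = A ∧ (u : Matrix n n E).det = t := by
  obtain ⟨w, hw, hwA⟩ := Matrix.exists_vecMul_eq_zero_iff.mpr hA
  obtain ⟨i, hi⟩ := Function.ne_iff.mp hw
  have hi' : w i ≠ 0 := hi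
  set v : n → E := Pi.single i ((t - 1) / w i)
  have hdet : (1 + Matrix.vecMulVec v w).det = t := by
    rw [Matrix.vecMulVec_eq Unit, Matrix.det_one_add_replicateCol_mul_replicateRow]
    simp [v]
    field_simp
    ring
  refine ⟨Matrix.GeneralLinearGroup.mkOfDetNeZero _ (hdet ▸ ht), ?_, hdet⟩
  change (1 + Matrix.vecMulVec v w) * A = A
  rw [add_mul, one_mul, Matrix.vecMulVec_mul, hwA]
  simp

/-- A function vanishing on singular matrices may be summed over invertible matrices only. -/
lemma sum_eq_sum_units [Fintype E] [DecidableEq E] {M : Type*} [AddCommMonoid M]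
    (f : Matrix n n E → M) (hf : ∀ A, A.det = 0 → f A = 0) :
    ∑ A, f A = ∑ g : GL n E, f g := by
  symm
  refine Finset.sum_of_injOn (fun g : GL n E => (g : Matrix n n E))
    (fun _ _ _ _ h => Units.ext h) (by simp) ?_ (by simp)
  intro A _ hA
  apply hf
  by_contra h
  exact hA ⟨Matrix.GeneralLinearGroup.mkOfDetNeZero A h, by simp, rfl⟩

lemma mulChar_det_ne_zero (χ : MulChar E ℂ) (u : GL n E) : χ (u : Matrix n n E).det ≠ 0 :=
  ((Matrix.isUnit_iff_isUnit_det _).mp u.isUnit |>.map χ).ne_zero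

lemma inv_mulChar_apply (χ : MulChar E ℂ) (a : E) : χ⁻¹ a = (χ a)⁻¹ := by
  rw [MulChar.inv_apply_eq_inv, Ring.inverse_eq_inv']

lemma card_square_matrix {R : Type*} [Fintype R] [DecidableEq R] :
    (Fintype.card (Matrix n n R) : ℂ) = (Fintype.card R : ℂ) ^ (Fintype.card n ^ 2) := by
  rw [Fintype.card_congr (Matrix.of (m := n) (n := n) (α := R)).symm]
  simp [sq, pow_mul]

variable [Fintype E] [DecidableEq E]

/-- The matrix Gauss sum `∑_h χ(det h) ψ(tr (h A))` attached to a matrix `A`. -/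
noncomputable def gaussSumAt (χ : MulChar E ℂ) (ψ : AddChar E ℂ) (A : Matrix n n E) : ℂ :=
  ∑ h : GL n E, χ (h : Matrix n n E).det * ψ ((h : Matrix n n E) * A).trace

variable (χ : MulChar E ℂ) (ψ : AddChar E ℂ)

lemma gaussSumAt_units_mul (u : GL n E) (A : Matrix n n E) :
    χ (u : Matrix n n E).det * gaussSumAt χ ψ ((u : Matrix n n E) * A) = gaussSumAt χ ψ A := by
  symm
  unfold gaussSumAt
  rw [← Equiv.sum_comp (Equiv.mulRight u), Finset.mul_sum]
  refine Finset.sum_congr rfl fun h _ => ?_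
  simp only [Equiv.coe_mulRight, Units.val_mul, Matrix.det_mul, map_mul, mul_assoc]
  ring

lemma gaussSumAt_of_det_eq_zero (hχ : χ ≠ 1) {A : Matrix n n E} (hA : A.det = 0) :
    gaussSumAt χ ψ A = 0 := by
  obtain ⟨t, ht⟩ := (MulChar.ne_one_iff).mp hχ
  obtain ⟨u, huA, hu⟩ := exists_mul_eq_self_of_det_eq_zero hA t.ne_zero
  have h := gaussSumAt_units_mul χ ψ u A
  rw [huA, hu] at h
  by_contra h0
  exact ht ((mul_eq_right₀ h0).mp h)

lemma gaussSumAt_units (u : GL n E) :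
    gaussSumAt χ ψ (u : Matrix n n E) =
      (χ (u : Matrix n n E).det)⁻¹ * gaussSumAt χ ψ (1 : Matrix n n E) := by
  have h := gaussSumAt_units_mul χ ψ u 1
  rw [mul_one] at h
  rw [← h, inv_mul_cancel_left₀ (mulChar_det_ne_zero χ u)]

/-- Orthogonality for the characters `A ↦ ψ(tr (B A))` of the additive group of matrices. -/
lemma sum_addChar_trace_mul (hψ : ψ ≠ 1) (B : Matrix n n E) :
    ∑ A : Matrix n n E, ψ (B * A).trace =
      if B = 0 then (Fintype.card E : ℂ) ^ (Fintype.card n ^ 2) else 0 := by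
  split_ifs with hB
  · simp [hB, card_square_matrix]
  · obtain ⟨c, hc⟩ := (AddChar.ne_one_iff).mp hψ
    obtain ⟨i, j, hij⟩ : ∃ i j, B i j ≠ 0 := by
      by_contra! h
      exact hB (Matrix.ext h)
    let φ : AddChar (Matrix n n E) ℂ := ψ.compAddMonoidHom
      ((Matrix.traceAddMonoidHom n E).comp (AddMonoidHom.mulLeft B))
    have hφ : φ ≠ 1 := AddChar.ne_one_iff.mpr ⟨Matrix.single j i (c / B i j), by
      change ψ (B * Matrix.single j i (c / B i j)).trace ≠ 1
      rwa [Matrix.trace_mul_single, op_smul_eq_mul, mul_div_cancel₀ _ hij]⟩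
    exact AddChar.sum_eq_zero_of_ne_one hφ

lemma gaussSumAt_one_mul_gaussSumAt_inv (hχ : χ ≠ 1) (hψ : ψ ≠ 1) :
    χ (-1) ^ Fintype.card n * gaussSumAt χ ψ (1 : Matrix n n E) *
      gaussSumAt χ⁻¹ ψ (1 : Matrix n n E) = (Fintype.card E : ℂ) ^ (Fintype.card n ^ 2) := by
  have key : ∑ A : Matrix n n E, gaussSumAt χ ψ A * ψ (-A).trace =
      (Fintype.card E : ℂ) ^ (Fintype.card n ^ 2) := by
    simp only [gaussSumAt, Finset.sum_mul]
    rw [Finset.sum_comm, Finset.sum_eq_single (1 : GL n E)]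
    · simp [← AddChar.map_add_eq_mul, card_square_matrix]
    · intro h _ hh
      have : (h : Matrix n n E) - 1 ≠ 0 := fun e => hh (Units.ext (sub_eq_zero.mp e))
      have h0 := sum_addChar_trace_mul ψ hψ ((h : Matrix n n E) - 1)
      rw [if_neg this] at h0
      simp only [mul_assoc, ← AddChar.map_add_eq_mul, ← Matrix.trace_add, ← sub_eq_add_neg]
      rw [← Finset.mul_sum]
      simp only [sub_mul, one_mul] at h0
      rw [h0, mul_zero]
    · simp
  rw [sum_eq_sum_units _ fun A hA => by rw [gaussSumAt_of_det_eq_zero χ ψ hχ hA, zero_mul],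
    ← Equiv.sum_comp (Equiv.neg _)] at key
  rw [← key, gaussSumAt.eq_1 χ⁻¹, Finset.mul_sum]
  refine Finset.sum_congr rfl fun h _ => ?_
  have hsq : χ (-1) * χ (-1) = 1 := by rw [← map_mul]; simp
  rw [gaussSumAt_units]
  simp only [Equiv.neg_apply, Units.val_neg, neg_neg, mul_one, Matrix.det_neg, map_mul, map_pow,
    mul_inv, inv_mulChar_apply, ← inv_pow, inv_eq_of_mul_eq_one_left hsq]
  ring

end MatrixGaussSum

/-- For a finite field `E` of odd characteristic, `k ≥ 1`, a nontrivial
multiplicative character `χ` and a nontrivial additive character `ψ` of `E`, and a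
representation `π` of `GL_k(E)` on a finite-dimensional complex vector space `V`:
`∑_{g, det(I+g) ≠ 0} χ(det(I+g)) π(g)
  = χ(-1)^k |E|^{-k²} (∑_h χ(det h) ψ(tr h)) ·
    (∑_y χ(det y)⁻¹ ψ(tr y) π(y⁻¹)) ∘ (∑_x ψ(tr x) π(x))`. -/
theorem jacobi_sum_operator_as_gauss_sums
    (E : Type*) [Field E] [Fintype E] [DecidableEq E] (hE : ringChar E ≠ 2)
    (k : ℕ) (hk : 1 ≤ k)
    (χ : MulChar E ℂ) (hχ : χ ≠ 1) (ψ : AddChar E ℂ) (hψ : ψ ≠ 1)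
    (V : Type*) [AddCommGroup V] [Module ℂ V] [FiniteDimensional ℂ V]
    (π : Representation ℂ (GL (Fin k) E) V) :
    (∑ g ∈ Finset.univ.filter
        (fun g : GL (Fin k) E => (1 + (g : Matrix (Fin k) (Fin k) E)).det ≠ 0),
      χ ((1 + (g : Matrix (Fin k) (Fin k) E)).det) • π g) =
    (χ (-1) ^ k * (Fintype.card E : ℂ) ^ (-(k ^ 2 : ℤ)) *
        ∑ h : GL (Fin k) E,
          χ ((h : Matrix (Fin k) (Fin k) E).det) *
            ψ ((h : Matrix (Fin k) (Fin k) E).trace)) •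
      ((∑ y : GL (Fin k) E,
          ((χ ((y : Matrix (Fin k) (Fin k) E).det))⁻¹ *
            ψ ((y : Matrix (Fin k) (Fin k) E).trace)) • π y⁻¹) ∘ₗ
        (∑ x : GL (Fin k) E, ψ ((x : Matrix (Fin k) (Fin k) E).trace) • π x)) := by
  classical
  have hinv : χ⁻¹ ≠ 1 := inv_ne_one.mpr hχ
  have hcard : (Fintype.card E : ℂ) ≠ 0 := Nat.cast_ne_zero.mpr Fintype.card_ne_zero
  have hG := MatrixGaussSum.gaussSumAt_one_mul_gaussSumAt_inv (n := Fin k) χ ψ hχ hψ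
  rw [Fintype.card_fin] at hG
  have hcomp : (∑ y : GL (Fin k) E,
          ((χ ((y : Matrix (Fin k) (Fin k) E).det))⁻¹ *
            ψ ((y : Matrix (Fin k) (Fin k) E).trace)) • π y⁻¹) ∘ₗ
        (∑ x : GL (Fin k) E, ψ ((x : Matrix (Fin k) (Fin k) E).trace) • π x) =
      ∑ g : GL (Fin k) E,
        MatrixGaussSum.gaussSumAt χ⁻¹ ψ (1 + (g : Matrix (Fin k) (Fin k) E)) • π g := by
    simp only [← Module.End.mul_eq_comp, MatrixGaussSum.gaussSumAt, Finset.sum_mul,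
      Finset.sum_smul]
    rw [Finset.sum_comm]
    refine Finset.sum_congr rfl fun y _ => ?_
    rw [Finset.mul_sum, ← Equiv.sum_comp (Equiv.mulLeft y)]
    refine Finset.sum_congr rfl fun g _ => ?_
    rw [smul_mul_smul_comm, ← map_mul, MatrixGaussSum.inv_mulChar_apply]
    simp [mul_add, AddChar.map_add_eq_mul, mul_assoc]
  have hsum : ∑ h : GL (Fin k) E, χ ((h : Matrix (Fin k) (Fin k) E).det) *
      ψ ((h : Matrix (Fin k) (Fin k) E).trace) =
      MatrixGaussSum.gaussSumAt χ ψ (1 : Matrix (Fin k) (Fin k) E) := by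
    simp [MatrixGaussSum.gaussSumAt]
  rw [hcomp, hsum, Finset.smul_sum, Finset.sum_filter]
  refine Finset.sum_congr rfl fun g _ => ?_
  split_ifs with hg
  · have hu := MatrixGaussSum.gaussSumAt_units χ⁻¹ ψ
      (Matrix.GeneralLinearGroup.mkOfDetNeZero _ hg)
    change MatrixGaussSum.gaussSumAt χ⁻¹ ψ (1 + (g : Matrix (Fin k) (Fin k) E)) =
      (χ⁻¹ (1 + (g : Matrix (Fin k) (Fin k) E)).det)⁻¹ * _ at hu
    rw [MatrixGaussSum.inv_mulChar_apply, inv_inv] at hu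
    rw [hu, smul_smul]
    congr 1
    rw [zpow_neg, show ((k : ℤ) ^ 2) = ((k ^ 2 : ℕ) : ℤ) by push_cast; rfl, zpow_natCast]
    field_simp
    rw [← hG]
    ring
  · rw [MatrixGaussSum.gaussSumAt_of_det_eq_zero χ⁻¹ ψ hinv (not_not.mp hg), zero_smul,
      smul_zero]
end

section
/- Let E be a finite field of odd characteristic, k ≥ 1, χ a nontrivial multiplicative character of E, and ψ a nontrivial additive character of E. Let π be a representation of GL_k(E) on a finite-dimensional complex vector space V, and suppose a, b ∈ ℂ satisfy ∑_{g ∈ GL_k(E)} ψ(tr g) π(g) = a · id_V and ∑_{g ∈ GL_k(E)} χ(det g) ψ(tr(g⁻¹)) π(g) = b · id_V (by Schur's lemma such scalars exist when π is irreducible). Then ∑_{g ∈ GL_k(E), det(I+g) ≠ 0} χ(det(I + g)) · π(g) = χ(−1)^k · |E|^{−k(k+1)/2} · (∑_{x ∈ Eˣ} χ(x) ψ(x))^k · a · b · id_V. -/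
open scoped MatrixGroups

section MatrixGaussSum

open Matrix

variable {E : Type*} [Field E] {m n : Type*}

/-- A square matrix bordered by a column `r`, a row `c` and a corner entry `t`. -/
def Matrix.bordered (A : Matrix n n E) (r c : n → E) (t : E) : Matrix (n ⊕ Unit) (n ⊕ Unit) E :=
  fromBlocks A (replicateCol Unit r) (replicateRow Unit c) (of fun _ _ ↦ t)

/-- Decomposition of a square matrix into a bordered matrix. -/
def Matrix.borderedEquiv :
    Matrix n n E × (n → E) × (n → E) × E ≃ Matrix (n ⊕ Unit) (n ⊕ Unit) E where
  toFun p := bordered p.1 p.2.1 p.2.2.1 p.2.2.2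
  invFun M := (M.toBlocks₁₁, fun i ↦ M (.inl i) (.inr ()), fun i ↦ M (.inr ()) (.inl i),
    M (.inr ()) (.inr ()))
  left_inv _ := rfl
  right_inv M := by
    ext (i | i) (j | j) <;> rfl

variable [Fintype m] [Fintype n]

lemma Matrix.trace_bordered (A : Matrix n n E) (r c : n → E) (t : E) :
    (bordered A r c t).trace = A.trace + t := by
  simp [bordered, trace]

variable [DecidableEq m] [DecidableEq n]

lemma Matrix.det_bordered_of_det_ne_zero {A : Matrix n n E} (hA : A.det ≠ 0) (r c : n → E)
    (t : E) : (bordered A r c t).det = A.det * (t - c ⬝ᵥ A⁻¹ *ᵥ r) := by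
  let := invertibleOfIsUnitDet A hA.isUnit
  rw [bordered, det_fromBlocks₁₁, invOf_eq_nonsing_inv, det_unique (n := Unit), Matrix.mul_assoc,
    ← replicateCol_mulVec]
  rfl

lemma Matrix.det_bordered_of_det_eq_zero {A : Matrix n n E} (hA : A.det = 0) (r c : n → E)
    (t : E) : (bordered A r c t).det = (bordered A r c 0).det := by
  have h (u : n → E) (s : E) : updateRow (bordered A r c 0) (.inr ()) (Sum.elim u fun _ ↦ s) =
      bordered A r u s := by
    ext (i | i) (j | j) <;> simp [bordered]
  have hadd := det_updateRow_add (bordered A r c 0) (.inr ()) (Sum.elim c fun _ ↦ 0)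
    (Sum.elim 0 fun _ ↦ t)
  have hsum : (Sum.elim c fun _ ↦ 0) + (Sum.elim 0 fun _ ↦ t : n ⊕ Unit → E) =
      Sum.elim c fun _ ↦ t := by
    ext (i | i) <;> simp
  have hzero : (bordered A r 0 t).det = 0 := by
    rw [bordered, replicateRow_zero, det_fromBlocks_zero₂₁, hA, zero_mul]
  rwa [hsum, h, h, h, hzero, add_zero] at hadd

/-- A singular matrix is fixed under right multiplication by matrices of arbitrary determinant. -/
lemma exists_mul_eq_self_of_det_eq_zero {X : Matrix n n E} (hX : X.det = 0) (d : E) :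
    ∃ U : Matrix n n E, X * U = X ∧ U.det = d := by
  obtain ⟨v, hv, hXv⟩ := exists_mulVec_eq_zero_iff.mpr hX
  obtain ⟨i, hi⟩ := Function.ne_iff.mp hv
  refine ⟨1 + replicateCol Unit v * replicateRow Unit (Pi.single i ((d - 1) / v i)), ?_, ?_⟩
  · rw [Matrix.mul_add, ← Matrix.mul_assoc, ← replicateCol_mulVec, hXv]
    simp
  · rw [det_one_add_replicateCol_mul_replicateRow, single_dotProduct, div_mul_cancel₀ _ hi]
    ring

variable [Fintype E]

/-- The Gauss sum over all square matrices attached to a multiplicative character `χ`, an additive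
character `ψ` and a matrix `X`. -/
noncomputable def matrixGaussSum (χ : MulChar E ℂ) (ψ : AddChar E ℂ) (X : Matrix n n E) : ℂ :=
  ∑ M : Matrix n n E, χ M.det * ψ (X * M).trace

lemma matrixGaussSum_mul_right (χ : MulChar E ℂ) (ψ : AddChar E ℂ) (X U : Matrix n n E)
    (hU : U.det ≠ 0) :
    matrixGaussSum χ ψ (X * U) = χ⁻¹ U.det * matrixGaussSum χ ψ X := by
  have hU' : IsUnit U.det := hU.isUnit
  rw [matrixGaussSum, matrixGaussSum, Finset.mul_sum]
  refine Fintype.sum_equiv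
    { toFun := fun M ↦ U * M
      invFun := fun M ↦ U⁻¹ * M
      left_inv := fun M ↦ nonsing_inv_mul_cancel_left U M hU'
      right_inv := fun M ↦ mul_nonsing_inv_cancel_left U M hU' } _ _ fun M ↦ ?_
  have h : χ⁻¹ U.det * χ U.det = 1 := by
    rw [← MulChar.mul_apply, inv_mul_cancel, MulChar.one_apply hU']
  simp only [Equiv.coe_fn_mk, det_mul, map_mul, Matrix.mul_assoc]
  linear_combination (-χ M.det * ψ (X * (U * M)).trace) * h

lemma matrixGaussSum_eq (χ : MulChar E ℂ) (hχ : χ ≠ 1) (ψ : AddChar E ℂ) (X : Matrix n n E) :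
    matrixGaussSum χ ψ X = χ⁻¹ X.det * matrixGaussSum χ ψ (1 : Matrix n n E) := by
  by_cases hX : X.det = 0
  · obtain ⟨d, hd⟩ := (MulChar.ne_one_iff (χ := χ⁻¹)).mp (inv_ne_one.mpr hχ)
    obtain ⟨U, hXU, hU⟩ := exists_mul_eq_self_of_det_eq_zero hX (d : E)
    have h := matrixGaussSum_mul_right χ ψ X U (hU ▸ d.ne_zero)
    rw [hXU, hU] at h
    rw [hX, MulChar.map_zero, zero_mul]
    exact (mul_left_eq_self₀.mp h.symm).resolve_left hd
  · simpa using matrixGaussSum_mul_right χ ψ 1 X hX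

lemma matrixGaussSum_one_reindex (χ : MulChar E ℂ) (ψ : AddChar E ℂ) (e : m ≃ n) :
    matrixGaussSum χ ψ (1 : Matrix m m E) = matrixGaussSum χ ψ (1 : Matrix n n E) := by
  refine Fintype.sum_equiv (reindex e e) _ _ fun M ↦ ?_
  rw [det_reindex_self, Matrix.one_mul, Matrix.one_mul, reindex_apply]
  congr 2
  exact (Fintype.sum_equiv e.symm _ _ fun _ ↦ rfl).symm

lemma sum_addChar_dotProduct {ψ : AddChar E ℂ} (hψ : ψ ≠ 1) (v : n → E)
    [Decidable (v = 0)] :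
    ∑ c : n → E, ψ (c ⬝ᵥ v) = if v = 0 then (Fintype.card E : ℂ) ^ Fintype.card n else 0 := by
  split_ifs with hv
  · simp [hv]
  · obtain ⟨i, hi⟩ := Function.ne_iff.mp hv
    obtain ⟨x, hx⟩ := AddChar.ne_one_iff.mp hψ
    let φ : AddChar (n → E) ℂ :=
      { toFun := fun c ↦ ψ (c ⬝ᵥ v)
        map_zero_eq_one' := by simp
        map_add_eq_mul' := fun c d ↦ by rw [add_dotProduct, AddChar.map_add_eq_mul] }
    refine AddChar.sum_eq_zero_of_ne_one (ψ := φ) (AddChar.ne_one_iff.mpr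
      ⟨Pi.single i (x / v i), ?_⟩)
    change ψ (Pi.single i (x / v i) ⬝ᵥ v) ≠ 1
    rwa [single_dotProduct, div_mul_cancel₀ _ hi]

lemma sum_bordered (χ : MulChar E ℂ) {ψ : AddChar E ℂ} (hψ : ψ ≠ 1) (A : Matrix n n E) :
    ∑ r : n → E, ∑ c : n → E, ∑ t : E, χ (bordered A r c t).det * ψ (bordered A r c t).trace =
      gaussSum χ ψ * (Fintype.card E : ℂ) ^ Fintype.card n * (χ A.det * ψ A.trace) := by
  classical
  simp_rw [trace_bordered, AddChar.map_add_eq_mul]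
  by_cases hA : A.det = 0
  · simp_rw [det_bordered_of_det_eq_zero hA _ _ _, ← Finset.mul_sum,
      AddChar.sum_eq_zero_of_ne_one hψ, hA, MulChar.map_zero]
    simp
  · have h (r c : n → E) : ∑ t : E, χ (bordered A r c t).det * (ψ A.trace * ψ t) =
        ψ (c ⬝ᵥ A⁻¹ *ᵥ r) * (gaussSum χ ψ * (χ A.det * ψ A.trace)) := by
      simp only [gaussSum, Finset.mul_sum, Finset.sum_mul]
      refine Fintype.sum_equiv (Equiv.subRight (c ⬝ᵥ A⁻¹ *ᵥ r)) _ _ fun t ↦ ?_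
      have ht : ψ t = ψ (t - c ⬝ᵥ A⁻¹ *ᵥ r) * ψ (c ⬝ᵥ A⁻¹ *ᵥ r) := by
        rw [← AddChar.map_add_eq_mul, sub_add_cancel]
      rw [det_bordered_of_det_ne_zero hA, map_mul, ht, Equiv.subRight_apply]
      ring
    have hinv (r : n → E) : A⁻¹ *ᵥ r = 0 ↔ r = 0 := by
      refine ⟨fun hr ↦ ?_, fun hr ↦ by rw [hr, mulVec_zero]⟩
      rw [← one_mulVec r, ← mul_nonsing_inv A (Ne.isUnit hA), ← mulVec_mulVec, hr, mulVec_zero]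
    simp_rw [h, ← Finset.sum_mul, sum_addChar_dotProduct hψ, hinv]
    rw [Finset.sum_ite_eq' Finset.univ (0 : n → E), if_pos (Finset.mem_univ _)]
    ring

lemma matrixGaussSum_one_sum_unit (χ : MulChar E ℂ) {ψ : AddChar E ℂ} (hψ : ψ ≠ 1) :
    matrixGaussSum χ ψ (1 : Matrix (n ⊕ Unit) (n ⊕ Unit) E) =
      gaussSum χ ψ * (Fintype.card E : ℂ) ^ Fintype.card n *
        matrixGaussSum χ ψ (1 : Matrix n n E) := by
  simp only [matrixGaussSum, Matrix.one_mul]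
  rw [← borderedEquiv.sum_comp, Fintype.sum_prod_type, Finset.mul_sum]
  refine Finset.sum_congr rfl fun A _ ↦ ?_
  rw [← sum_bordered χ hψ]
  simp only [Fintype.sum_prod_type]
  rfl

lemma matrixGaussSum_one_fin (χ : MulChar E ℂ) {ψ : AddChar E ℂ} (hψ : ψ ≠ 1) (k : ℕ) :
    matrixGaussSum χ ψ (1 : Matrix (Fin k) (Fin k) E) =
      (Fintype.card E : ℂ) ^ (k * (k - 1) / 2) * gaussSum χ ψ ^ k := by
  rw [← Finset.sum_range_id]
  induction k with
  | zero =>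
    have : Fintype.card (Matrix (Fin 0) (Fin 0) E) = 1 := Fintype.card_eq_one_iff.mpr
      ⟨0, fun _ ↦ Subsingleton.elim _ _⟩
    simp [matrixGaussSum, this]
  | succ k ih =>
    rw [← matrixGaussSum_one_reindex χ ψ
      ((Equiv.sumCongr (Equiv.refl (Fin k)) (Equiv.equivPUnit (Fin 1)).symm).trans finSumFinEquiv),
      matrixGaussSum_one_sum_unit χ hψ, ih, Fintype.card_fin, Finset.sum_range_succ]
    ring

lemma gaussSum_mul_gaussSum_inv {χ : MulChar E ℂ} (hχ : χ ≠ 1) {ψ : AddChar E ℂ} (hψ : ψ ≠ 1) :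
    χ (-1) * gaussSum χ ψ * gaussSum χ⁻¹ ψ = Fintype.card E := by
  have h := gaussSum_mul_gaussSum_eq_card (inv_ne_one.mpr hχ) (AddChar.IsPrimitive.of_ne_one hψ)
  rw [inv_inv] at h
  have hsq : χ (-1) * χ (-1) = 1 := by rw [← map_mul]; simp
  rw [← h, ← mul_gaussSum_inv_eq_gaussSum χ ψ]
  linear_combination (gaussSum χ ψ⁻¹ * gaussSum χ⁻¹ ψ) * hsq

variable [DecidableEq E]

lemma sum_GL_eq_matrixGaussSum (χ : MulChar E ℂ) (ψ : AddChar E ℂ) (X : Matrix n n E) :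
    ∑ h : GL n E, χ (h : Matrix n n E).det * ψ (X * (h : Matrix n n E)).trace =
      matrixGaussSum χ ψ X := by
  refine Finset.sum_of_injOn (fun h : GL n E ↦ (h : Matrix n n E)) Units.val_injective.injOn
    (fun _ _ ↦ Finset.mem_univ _) (fun M _ hM ↦ ?_) fun _ _ ↦ rfl
  rw [MulChar.map_nonunit, zero_mul]
  intro hdet
  obtain ⟨u, hu⟩ := (isUnit_iff_isUnit_det M).mpr hdet
  exact hM ⟨u, by simp, hu⟩

lemma gaussSum_eq_sum_units (χ : MulChar E ℂ) (ψ : AddChar E ℂ) :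
    gaussSum χ ψ = ∑ x : Eˣ, χ (x : E) * ψ (x : E) := by
  refine (Finset.sum_of_injOn (fun x : Eˣ ↦ (x : E)) Units.val_injective.injOn
    (fun _ _ ↦ Finset.mem_univ _) (fun x _ hx ↦ ?_) fun _ _ ↦ rfl).symm
  rw [MulChar.map_nonunit, zero_mul]
  rintro ⟨u, hu⟩
  exact hx ⟨u, by simp, hu⟩

lemma sum_inv_GL_eq_matrixGaussSum (χ : MulChar E ℂ) (hχ : χ ≠ 1) (ψ : AddChar E ℂ)
    (g : GL n E) :
    ∑ h : GL n E, ψ ((g * h⁻¹ : GL n E) : Matrix n n E).trace *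
        (χ (h : Matrix n n E).det * ψ ((h⁻¹ : GL n E) : Matrix n n E).trace) =
      χ (1 + (g : Matrix n n E)).det * matrixGaussSum χ⁻¹ ψ (1 : Matrix n n E) := by
  have h := matrixGaussSum_eq χ⁻¹ (inv_ne_one.mpr hχ) ψ (1 + (g : Matrix n n E))
  rw [inv_inv] at h
  rw [← h, ← sum_GL_eq_matrixGaussSum]
  refine Fintype.sum_equiv (Equiv.inv _) _ _ fun h ↦ ?_
  have hdet : χ⁻¹ ((h⁻¹ : GL n E) : Matrix n n E).det = χ (h : Matrix n n E).det := by
    rw [MulChar.inv_apply', coe_units_inv, det_nonsing_inv, Ring.inverse_eq_inv', inv_inv]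
  rw [Equiv.inv_apply, hdet, Matrix.add_mul, Matrix.one_mul, trace_add, AddChar.map_add_eq_mul,
    Units.val_mul]
  ring

/-- The product of two Kondo type sums is a multiple of the Jacobi type sum. -/
lemma kondo_mul_kondo {V : Type*} [AddCommGroup V] [Module ℂ V]
    (χ : MulChar E ℂ) (hχ : χ ≠ 1) (ψ : AddChar E ℂ) (π : Representation ℂ (GL n E) V) :
    (∑ g : GL n E, ψ (g : Matrix n n E).trace • π g) *
      (∑ h : GL n E, (χ (h : Matrix n n E).det *
        ψ ((h⁻¹ : GL n E) : Matrix n n E).trace) • π h) =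
      matrixGaussSum χ⁻¹ ψ (1 : Matrix n n E) •
        ∑ g : GL n E, χ (1 + (g : Matrix n n E)).det • π g := by
  have hshift (h : GL n E) : (∑ g : GL n E, ψ (g : Matrix n n E).trace • π g) * π h =
      ∑ g : GL n E, ψ ((g * h⁻¹ : GL n E) : Matrix n n E).trace • π g := by
    rw [Finset.sum_mul]
    refine Fintype.sum_equiv (Equiv.mulRight h) _ _ fun g ↦ ?_
    rw [Equiv.coe_mulRight, mul_inv_cancel_right, map_mul, smul_mul_assoc]
  simp_rw [Finset.mul_sum, mul_smul_comm, hshift, Finset.smul_sum]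
  rw [Finset.sum_comm]
  refine Finset.sum_congr rfl fun g _ ↦ ?_
  simp_rw [smul_smul, ← Finset.sum_smul]
  rw [mul_comm (matrixGaussSum _ _ _), ← sum_inv_GL_eq_matrixGaussSum χ hχ]
  simp_rw [mul_comm]

end MatrixGaussSum

/-- For a finite field `E` of odd characteristic, `k ≥ 1`, a nontrivial
multiplicative character `χ` and a nontrivial additive character `ψ` of `E`, and a
representation `π` of `GL_k(E)` on a finite-dimensional complex vector space `V`:
if `∑_g ψ(tr g) π(g) = a • id` and `∑_g χ(det g) ψ(tr g⁻¹) π(g) = b • id`, then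
`∑_{g, det(I+g) ≠ 0} χ(det(I+g)) π(g)
  = χ(-1)^k |E|^{-k(k+1)/2} (∑_{x ∈ Eˣ} χ(x) ψ(x))^k · a · b • id`. -/
theorem jacobi_sum_scalar_in_terms_of_kondo
    (E : Type*) [Field E] [Fintype E] [DecidableEq E] (hE : ringChar E ≠ 2)
    (k : ℕ) (hk : 1 ≤ k)
    (χ : MulChar E ℂ) (hχ : χ ≠ 1) (ψ : AddChar E ℂ) (hψ : ψ ≠ 1)
    (V : Type*) [AddCommGroup V] [Module ℂ V] [FiniteDimensional ℂ V]
    (π : Representation ℂ (GL (Fin k) E) V) (a b : ℂ)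
    (ha : ∑ g : GL (Fin k) E, ψ ((g : Matrix (Fin k) (Fin k) E).trace) • π g =
      a • (LinearMap.id : V →ₗ[ℂ] V))
    (hb : ∑ g : GL (Fin k) E,
        (χ ((g : Matrix (Fin k) (Fin k) E).det) *
          ψ (((g⁻¹ : GL (Fin k) E) : Matrix (Fin k) (Fin k) E).trace)) • π g =
      b • (LinearMap.id : V →ₗ[ℂ] V)) :
    (∑ g ∈ Finset.univ.filter
        (fun g : GL (Fin k) E => (1 + (g : Matrix (Fin k) (Fin k) E)).det ≠ 0),
      χ ((1 + (g : Matrix (Fin k) (Fin k) E)).det) • π g) =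
    (χ (-1) ^ k * (Fintype.card E : ℂ) ^ (-(k * (k + 1) / 2 : ℕ) : ℤ) *
      (∑ x : Eˣ, χ (x : E) * ψ (x : E)) ^ k * a * b) •
      (LinearMap.id : V →ₗ[ℂ] V) := by
  have hq : (Fintype.card E : ℂ) ≠ 0 := Nat.cast_ne_zero.mpr Fintype.card_ne_zero
  have hG := gaussSum_mul_gaussSum_inv hχ hψ
  have hfilter : (∑ g ∈ Finset.univ.filter
        (fun g : GL (Fin k) E => (1 + (g : Matrix (Fin k) (Fin k) E)).det ≠ 0),
      χ ((1 + (g : Matrix (Fin k) (Fin k) E)).det) • π g) =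
      ∑ g : GL (Fin k) E, χ ((1 + (g : Matrix (Fin k) (Fin k) E)).det) • π g := by
    refine Finset.sum_filter_of_ne fun g _ hg hdet ↦ hg ?_
    rw [hdet, MulChar.map_zero, zero_smul]
  have hprod := kondo_mul_kondo χ hχ ψ π
  have hexp : k * (k + 1) / 2 = k * (k - 1) / 2 + k := by
    rw [← Finset.sum_range_id, ← Finset.sum_range_succ, Finset.sum_range_id, Nat.add_sub_cancel,
      mul_comm]
  have hscalar : χ (-1) ^ k * (Fintype.card E : ℂ) ^ (-(k * (k + 1) / 2 : ℕ) : ℤ) * gaussSum χ ψ ^ k *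
      matrixGaussSum χ⁻¹ ψ (1 : Matrix (Fin k) (Fin k) E) = 1 := by
    rw [matrixGaussSum_one_fin χ⁻¹ hψ, zpow_neg, zpow_natCast, hexp, pow_add]
    have hGk : χ (-1) ^ k * gaussSum χ ψ ^ k * gaussSum χ⁻¹ ψ ^ k = (Fintype.card E : ℂ) ^ k := by
      rw [← mul_pow, ← mul_pow, hG]
    field_simp
    linear_combination hGk
  rw [ha, hb] at hprod
  rw [hfilter, ← gaussSum_eq_sum_units, ← one_smul ℂ (∑ g : GL (Fin k) E, _), ← hscalar, mul_smul,
    ← hprod, smul_mul_smul_comm, smul_smul, ← mul_assoc]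
  rfl
end

section
/- Let E be a finite field of odd characteristic and let K/E be a finite field extension of degree k. Let χ be a nontrivial multiplicative character of E, let α be a multiplicative character of K, and let ψ_K be a nontrivial additive character of K. Then ∑_{x ∈ Kˣ, x ≠ −1} α(x) · χ(N_{K/E}(1 + x)) = χ(−1)^k · |K|^{−1} · (∑_{z ∈ Kˣ} α(z)⁻¹ χ(N_{K/E}(z))⁻¹ ψ_K(z)) · (∑_{x ∈ Kˣ} α(x) ψ_K(x)) · (∑_{y ∈ Kˣ} χ(N_{K/E}(y)) ψ_K(y)). -/
namespace MulChar

section NormComp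

variable {E K R : Type*} [Field E] [Field K] [Finite K] [Algebra E K] [CommRing R]

/-- The multiplicative character `χ ∘ N_{K/E}` of a finite field `K`. -/
noncomputable def normComp (K : Type*) [Field K] [Finite K] [Algebra E K] (χ : MulChar E R) :
    MulChar K R where
  toMonoidHom := χ.toMonoidHom.comp (Algebra.norm E)
  map_nonunit' a ha := by
    have ha : a = 0 := by simpa using ha
    subst ha
    exact (congrArg χ (Algebra.norm_zero (R := E) (S := K))).trans χ.map_zero

@[simp]
lemma normComp_apply (χ : MulChar E R) (x : K) : χ.normComp K x = χ (Algebra.norm E x) := rfl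

lemma normComp_ne_one {χ : MulChar E R} (hχ : χ ≠ 1) : χ.normComp K ≠ 1 := by
  have : Finite E := Finite.of_injective _ (algebraMap E K).injective
  contrapose! hχ
  ext u
  obtain ⟨v, rfl⟩ := FiniteField.unitsMap_norm_surjective E K u
  have hv := congrArg (fun φ : MulChar K R ↦ φ v) hχ
  rw [MulChar.one_apply_coe]
  simpa using hv

lemma normComp_neg_one (χ : MulChar E R) :
    χ.normComp K (-1) = χ (-1) ^ Module.finrank E K := by
  rw [normComp_apply, ← map_pow, ← Algebra.norm_algebraMap, map_neg (algebraMap E K),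
    map_one]

end NormComp

lemma apply_neg_one_mul_self {S R : Type*} [CommRing S] [CommRing R] (χ : MulChar S R) :
    χ (-1) * χ (-1) = 1 := by
  rw [← map_mul, neg_one_mul, neg_neg, map_one]

variable {F R : Type*} [Field F] [Fintype F] [CommRing R]

lemma sum_units_mul_eq_sum [DecidableEq F] (χ : MulChar F R) (f : F → R) :
    ∑ u : Fˣ, χ u * f u = ∑ x, χ x * f x := by
  refine Finset.sum_of_injOn (fun u : Fˣ ↦ (u : F)) Units.val_injective.injOn (by simp) ?_
    (fun _ _ ↦ rfl)
  intro x _ hx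
  have hx : x = 0 := by
    by_contra h
    exact hx ⟨Units.mk0 x h, by simp⟩
  simp [hx]

lemma sum_units_mul_apply_one_add [DecidableEq F] (χ φ : MulChar F R) :
    ∑ u ∈ Finset.univ.filter (fun u : Fˣ ↦ (u : F) ≠ -1), χ u * φ (1 + u) =
      χ (-1) * jacobiSum χ φ := by
  rw [Finset.sum_filter_of_ne, sum_units_mul_eq_sum χ (fun x ↦ φ (1 + x)), jacobiSum,
    Finset.mul_sum]
  · refine Fintype.sum_equiv (Equiv.neg F) _ _ fun x ↦ ?_
    rw [Equiv.neg_apply, ← mul_assoc, ← map_mul, neg_one_mul, neg_neg, sub_neg_eq_add]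
  · intro u _ hu h
    simp [h] at hu

end MulChar

/-- The Jacobi sum of two characters, one of them nontrivial, as a product of three Gauss sums. -/
lemma card_mul_jacobiSum {F R : Type*} [Field F] [Fintype F] [CommRing R] [IsDomain R]
    {χ φ : MulChar F R} (hφ : φ ≠ 1) {ψ : AddChar F R} (hψ : ψ ≠ 1) :
    (Fintype.card F : R) * jacobiSum χ φ =
      (χ * φ) (-1) * gaussSum (χ * φ)⁻¹ ψ * gaussSum χ ψ * gaussSum φ ψ := by
  have hprim := AddChar.IsPrimitive.of_ne_one hψ
  by_cases h : χ * φ = 1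
  · obtain rfl : χ = φ⁻¹ := eq_inv_of_mul_eq_one_left h
    have hcard := gaussSum_mul_gaussSum_eq_card hφ hprim
    rw [jacobiSum_comm, jacobiSum_nontrivial_inv hφ, h, inv_one, gaussSum_one_left hψ,
      ← mul_gaussSum_inv_eq_gaussSum φ⁻¹ ψ, MulChar.inv_apply' φ, inv_neg_one,
      MulChar.one_apply isUnit_one.neg]
    linear_combination φ (-1) * hcard
  · have hcard := gaussSum_mul_gaussSum_eq_card h hprim
    have hneg := mul_gaussSum_inv_eq_gaussSum (χ * φ)⁻¹ ψ
    rw [MulChar.inv_apply' (χ * φ), inv_neg_one] at hneg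
    linear_combination -jacobiSum χ φ * hcard
      + (χ * φ) (-1) * gaussSum (χ * φ)⁻¹ ψ * jacobiSum_mul_nontrivial h ψ
      - jacobiSum χ φ * gaussSum (χ * φ) ψ * gaussSum (χ * φ)⁻¹ ψ⁻¹ *
        (MulChar.apply_neg_one_mul_self (χ * φ))
      + (χ * φ) (-1) * gaussSum (χ * φ) ψ * jacobiSum χ φ * hneg

/-- Let `E` be a finite field of odd characteristic and `K/E` a finite
extension of degree `k`. For a nontrivial multiplicative character `χ` of `E`,
a multiplicative character `α` of `K`, and a nontrivial additive character `ψ_K` of `K`: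
`∑_{x ∈ Kˣ, x ≠ -1} α(x) χ(N_{K/E}(1 + x))
  = χ(-1)^k |K|⁻¹ (∑_z α(z)⁻¹ χ(N(z))⁻¹ ψ_K(z)) (∑_x α(x) ψ_K(x)) (∑_y χ(N(y)) ψ_K(y))`. -/
theorem split_torus_jacobi_sum
    (E K : Type*) [Field E] [Field K] [Fintype K] [DecidableEq K] [Algebra E K]
    (hE : ringChar E ≠ 2) (k : ℕ) (hdeg : Module.finrank E K = k)
    (χ : MulChar E ℂ) (hχ : χ ≠ 1)
    (α : MulChar K ℂ)
    (ψK : AddChar K ℂ) (hψK : ψK ≠ 1) :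
    ∑ x ∈ Finset.univ.filter (fun x : Kˣ => (x : K) ≠ -1),
      α (x : K) * χ (Algebra.norm E (1 + (x : K))) =
    χ (-1) ^ k * (Fintype.card K : ℂ)⁻¹ *
      (∑ z : Kˣ, (α (z : K))⁻¹ * (χ (Algebra.norm E (z : K)))⁻¹ * ψK (z : K)) *
      (∑ x : Kˣ, α (x : K) * ψK (x : K)) *
      (∑ y : Kˣ, χ (Algebra.norm E (y : K)) * ψK (y : K)) := by
  have hα := α.apply_neg_one_mul_self
  have hJ := card_mul_jacobiSum (χ := α) (MulChar.normComp_ne_one (K := K) hχ) hψK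
  have hinv : ∑ z : Kˣ, (α (z : K))⁻¹ * (χ (Algebra.norm E (z : K)))⁻¹ * ψK (z : K) =
      gaussSum (α * χ.normComp K)⁻¹ ψK := by
    rw [gaussSum, ← MulChar.sum_units_mul_eq_sum]
    simp only [MulChar.inv_apply_eq_inv', MulChar.mul_apply, MulChar.normComp_apply, mul_inv]
  have hcard : (Fintype.card K : ℂ) ≠ 0 := Nat.cast_ne_zero.mpr Fintype.card_ne_zero
  rw [hinv]
  simp only [← MulChar.normComp_apply]
  rw [MulChar.sum_units_mul_apply_one_add, MulChar.sum_units_mul_eq_sum,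
    MulChar.sum_units_mul_eq_sum, ← gaussSum, ← gaussSum, ← hdeg,
    ← MulChar.normComp_neg_one (K := K)]
  rw [MulChar.mul_apply] at hJ
  field_simp
  linear_combination α (-1) * hJ + χ.normComp K (-1) * gaussSum (α * χ.normComp K)⁻¹ ψK *
    gaussSum α ψK * gaussSum (χ.normComp K) ψK * hα
end

section
/- Let E ⊆ K be finite fields of odd characteristic with [K:E] = k. Let σ_K be a ring automorphism of K mapping E onto itself, let σ_E be the induced automorphism of E, and assume: σ_E ∘ σ_E = id; N_{K/E}(σ_K(x)) = σ_E(N_{K/E}(x)) for all x ∈ K; and Tr_{K/E}(σ_K(x)) = σ_E(Tr_{K/E}(x)) for all x ∈ K. Let ψ be a nontrivial additive character of E with ψ ∘ σ_E = ψ, and set ψ_K := ψ ∘ Tr_{K/E}. Let α be a multiplicative character of K and χ a multiplicative character of E such that the character y ↦ χ(y·σ_E(y)) of Eˣ is nontrivial. Then ∑_{x ∈ Kˣ, x ≠ −1} α(x) · χ(N_{K/E}(1 + x)) · χ(N_{K/E}(1 + σ_K(x)⁻¹)) = (−1)^{k+1} · |E|^{−k} · (∑_{x ∈ Kˣ} α(x)⁻¹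 χ(N_{K/E}(x))⁻¹ ψ_K(x)) · (∑_{x ∈ Kˣ} α(σ_K(x)) χ(N_{K/E}(x))⁻¹ ψ_K(x)) · (∑_{y ∈ Eˣ} χ(y·σ_E(y)) ψ(y))^k. -/
open Polynomial in
theorem Polynomial.finite_setOf_monic_natDegree_eq (E : Type*) [Field E] [Finite E] (n : ℕ) :
    {f : E[X] | f.Monic ∧ f.natDegree = n}.Finite := by
  have : Finite (degreeLT E (n + 1)) := Finite.of_equiv _ (degreeLTEquiv E (n + 1)).toEquiv.symm
  refine Set.Finite.subset (Set.toFinite (degreeLT E (n + 1) : Set E[X])) ?_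
  rintro f ⟨hf, rfl⟩
  rw [SetLike.mem_coe, mem_degreeLT]
  exact (natDegree_lt_iff_degree_lt hf.ne_zero).1 (Nat.lt_succ_self _)

namespace HasseDavenport

open Polynomial Finset

/-- The finite set of monic polynomials of degree `n` over a finite field. -/
noncomputable def monics (E : Type*) [Field E] [Finite E] (n : ℕ) : Finset E[X] :=
  (finite_setOf_monic_natDegree_eq E n).toFinset

open Classical in
/-- The finite set of monic irreducible polynomials of degree at most `n` over a finite field. -/
noncomputable def irreds (E : Type*) [Field E] [Finite E] (n : ℕ) : Finset E[X] :=
  ((range (n + 1)).biUnion (monics E)).filter Irreducible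

/-- The function on polynomials attached to a pair of characters, whose value at the minimal
polynomial of `x` is the pair evaluated at the norm and the trace of `x`. -/
noncomputable def polyChar {E : Type*} [Field E] (χ : MulChar E ℂ) (ψ : AddChar E ℂ)
    (f : E[X]) : ℂ :=
  χ ((-1) ^ f.natDegree * f.coeff 0) * ψ (-f.nextCoeff)

theorem polyChar_one {E : Type*} [Field E] (χ : MulChar E ℂ) (ψ : AddChar E ℂ) :
    polyChar χ ψ 1 = 1 := by
  simp [polyChar, nextCoeff]

theorem polyChar_mul {E : Type*} [Field E] (χ : MulChar E ℂ) (ψ : AddChar E ℂ)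
    {f g : E[X]} (hf : f.Monic) (hg : g.Monic) :
    polyChar χ ψ (f * g) = polyChar χ ψ f * polyChar χ ψ g := by
  rw [polyChar, polyChar, polyChar, hf.natDegree_mul hg, hf.nextCoeff_mul hg, mul_coeff_zero,
    neg_add, AddChar.map_add_eq_mul, pow_add, mul_mul_mul_comm, map_mul]
  ring

theorem polyChar_minpoly {E : Type*} [Field E] (χ : MulChar E ℂ) (ψ : AddChar E ℂ)
    {K : Type*} [Field K] [Finite K] [Algebra E K] (x : K) :
    polyChar χ ψ (minpoly E x) ^ (Module.finrank E K / (minpoly E x).natDegree) =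
      χ (Algebra.norm E x) * ψ (Algebra.trace E K x) := by
  have hx := Algebra.IsIntegral.isIntegral (R := E) x
  have hd : Module.finrank E K / (minpoly E x).natDegree =
      Module.finrank (IntermediateField.adjoin E {x}) K := by
    rw [← Module.finrank_mul_finrank E (IntermediateField.adjoin E {x}) K,
      IntermediateField.adjoin.finrank hx, Nat.mul_div_cancel_left _ (minpoly.natDegree_pos hx)]
  rw [hd, Algebra.norm_eq_norm_adjoin, trace_eq_finrank_mul_minpoly_nextCoeff, ← nsmul_eq_mul,
    AddChar.map_nsmul_eq_pow, map_pow, ← mul_pow, polyChar]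
  have := Algebra.PowerBasis.norm_gen_eq_coeff_zero_minpoly (IntermediateField.adjoin.powerBasis hx)
  rw [IntermediateField.adjoin.powerBasis_gen, IntermediateField.minpoly_gen,
    IntermediateField.adjoin.powerBasis_dim] at this
  rw [this]

variable {E : Type*} [Field E] [Finite E]

theorem mem_monics {n : ℕ} {f : E[X]} : f ∈ monics E n ↔ f.Monic ∧ f.natDegree = n := by
  simp [monics]

theorem mem_irreds {n : ℕ} {f : E[X]} :
    f ∈ irreds E n ↔ f.Monic ∧ Irreducible f ∧ f.natDegree ≤ n := by
  simp [irreds, mem_monics]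
  grind

theorem sum_natDegree_mul_card_pow_dvd {f : E[X]} {n : ℕ} (hf : f ∈ monics E n)
    [DecidableRel ((· ∣ ·) : E[X] → E[X] → Prop)] :
    ∑ P ∈ irreds E n, P.natDegree * #{j ∈ Icc 1 n | P ^ j ∣ f} = n := by
  classical
  obtain ⟨hmonic, rfl⟩ := mem_monics.1 hf
  have h0 := hmonic.ne_zero
  have hmem {P : E[X]} (hP : P ∈ UniqueFactorizationMonoid.normalizedFactors f) :
      P ∈ irreds E f.natDegree := by
    refine mem_irreds.2 ⟨?_, UniqueFactorizationMonoid.irreducible_of_normalized_factor P hP,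
      natDegree_le_of_dvd (UniqueFactorizationMonoid.dvd_of_mem_normalizedFactors hP) h0⟩
    rw [← UniqueFactorizationMonoid.normalize_normalized_factor P hP]
    exact monic_normalize
      (UniqueFactorizationMonoid.irreducible_of_normalized_factor P hP).ne_zero
  have hdeg : f.natDegree = ((UniqueFactorizationMonoid.normalizedFactors f).map natDegree).sum := by
    rw [← natDegree_multiset_prod_of_monic _ fun P hP ↦ (mem_irreds.1 (hmem hP)).1,
      UniqueFactorizationMonoid.prod_normalizedFactors_eq h0, hmonic.normalize_eq_self]
  have hcard {P : E[X]} (hP : P ∈ irreds E f.natDegree) :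
      #{j ∈ Icc 1 f.natDegree | P ^ j ∣ f} =
        (UniqueFactorizationMonoid.normalizedFactors f).count P := by
    obtain ⟨hm, hi, -⟩ := mem_irreds.1 hP
    have hiff (j : ℕ) : P ^ j ∣ f ↔
        j ≤ (UniqueFactorizationMonoid.normalizedFactors f).count P := by
      rw [pow_dvd_iff_le_emultiplicity,
        UniqueFactorizationMonoid.emultiplicity_eq_count_normalizedFactors hi h0,
        hm.normalize_eq_self, Nat.cast_le]
    have hle : (UniqueFactorizationMonoid.normalizedFactors f).count P ≤ f.natDegree := by
      have := natDegree_le_of_dvd ((hiff _).2 le_rfl) h0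
      rw [natDegree_pow] at this
      exact (Nat.le_mul_of_pos_right _ hi.natDegree_pos).trans this
    conv_rhs =>
      rw [← Nat.add_sub_cancel (n := (UniqueFactorizationMonoid.normalizedFactors f).count P)
        (m := 1), ← Nat.card_Icc]
    congr 1
    ext j
    rw [mem_filter, hiff, mem_Icc, mem_Icc]
    omega
  conv_rhs => rw [hdeg, Finset.sum_multiset_map_count]
  rw [sum_congr rfl fun P hP ↦ by rw [hcard hP]]
  symm
  refine sum_subset_zero_on_sdiff (fun P hP ↦ hmem (Multiset.mem_toFinset.1 hP)) ?_ ?_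
  · intro P hP
    rw [mem_sdiff, Multiset.mem_toFinset] at hP
    rw [Multiset.count_eq_zero_of_notMem hP.2, mul_zero]
  · intro P _
    rw [smul_eq_mul, mul_comm]

theorem sum_monics_filter_pow_dvd {R : Type*} [CommRing R] (Λ : E[X] → R)
    (h1 : Λ 1 = 1) (hmul : ∀ f g : E[X], f.Monic → g.Monic → Λ (f * g) = Λ f * Λ g)
    [DecidableRel ((· ∣ ·) : E[X] → E[X] → Prop)] {P : E[X]} (hP : P.Monic) (j n : ℕ)
    (hj : j * P.natDegree ≤ n) :
    ∑ f ∈ monics E n with P ^ j ∣ f, Λ f =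
      Λ P ^ j * ∑ f ∈ monics E (n - j * P.natDegree), Λ f := by
  have hpow : Λ (P ^ j) = Λ P ^ j := by
    clear hj
    induction j with
    | zero => simp [h1]
    | succ j ih => rw [pow_succ, hmul _ _ (hP.pow j) hP, ih, pow_succ]
  rw [mul_sum]
  symm
  refine sum_bij (fun f _ ↦ P ^ j * f) ?_ ?_ ?_ ?_
  · intro f hf
    obtain ⟨hf, hd⟩ := mem_monics.1 hf
    refine mem_filter.2 ⟨mem_monics.2 ⟨(hP.pow j).mul hf, ?_⟩, dvd_mul_right _ _⟩
    rw [(hP.pow j).natDegree_mul hf, hP.natDegree_pow, hd]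
    omega
  · intro f _ g _ h
    exact mul_left_cancel₀ (hP.pow j).ne_zero h
  · intro f hf
    obtain ⟨hf, g, rfl⟩ := mem_filter.1 hf
    obtain ⟨hf, hd⟩ := mem_monics.1 hf
    have hg := (hP.pow j).of_mul_monic_left hf
    rw [(hP.pow j).natDegree_mul hg, hP.natDegree_pow] at hd
    exact ⟨g, mem_monics.2 ⟨hg, by omega⟩, rfl⟩
  · intro f hf
    rw [hmul _ _ (hP.pow j) (mem_monics.1 hf).1, hpow]

/-- The weighted power sum over irreducible polynomials of degree dividing `m`. -/
noncomputable def powerSum {R : Type*} [CommRing R] (Λ : E[X] → R) (m : ℕ) : R :=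
  ∑ P ∈ irreds E m with P.natDegree ∣ m, (P.natDegree : R) * Λ P ^ (m / P.natDegree)

/-- A Newton identity for a multiplicative function on monic polynomials: the logarithmic
derivative of the Euler product. -/
theorem natCast_mul_sum_monics {R : Type*} [CommRing R] (Λ : E[X] → R)
    (h1 : Λ 1 = 1) (hmul : ∀ f g : E[X], f.Monic → g.Monic → Λ (f * g) = Λ f * Λ g) (n : ℕ) :
    (n : R) * ∑ f ∈ monics E n, Λ f =
      ∑ m ∈ Icc 1 n, powerSum Λ m * ∑ f ∈ monics E (n - m), Λ f := by
  classical
  have key (f : E[X]) (hf : f ∈ monics E n) : (n : R) * Λ f =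
      ∑ P ∈ irreds E n, ∑ j ∈ Icc 1 n, if P ^ j ∣ f then (P.natDegree : R) * Λ f else 0 := by
    conv_lhs => rw [← sum_natDegree_mul_card_pow_dvd hf]
    rw [Nat.cast_sum, sum_mul]
    refine sum_congr rfl fun P _ ↦ ?_
    rw [← sum_filter, sum_const, nsmul_eq_mul]
    push_cast
    ring
  rw [mul_sum, sum_congr rfl key, sum_comm]
  have hR : ∑ m ∈ Icc 1 n, powerSum Λ m * ∑ f ∈ monics E (n - m), Λ f =
      ∑ P ∈ irreds E n, ∑ m ∈ Icc 1 n with P.natDegree ∣ m,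
        (P.natDegree : R) * Λ P ^ (m / P.natDegree) * ∑ f ∈ monics E (n - m), Λ f := by
    simp_rw [powerSum, sum_mul]
    refine sum_comm' fun m P ↦ ?_
    simp only [mem_filter, mem_irreds, mem_Icc]
    constructor
    · rintro ⟨⟨h1, h2⟩, ⟨h3, h4, h5⟩, h6⟩
      exact ⟨⟨⟨h1, h2⟩, h6⟩, h3, h4, h5.trans h2⟩
    · rintro ⟨⟨⟨h1, h2⟩, h6⟩, h3, h4, h5⟩
      exact ⟨⟨h1, h2⟩, ⟨h3, h4, Nat.le_of_dvd h1 h6⟩, h6⟩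
  rw [hR]
  refine sum_congr rfl fun P hP ↦ ?_
  obtain ⟨hm, hi, -⟩ := mem_irreds.1 hP
  have hd := hi.natDegree_pos
  rw [sum_comm]
  have hsub : ({j ∈ Icc 1 n | j * P.natDegree ≤ n} : Finset ℕ) ⊆ Icc 1 n := filter_subset _ _
  rw [← sum_subset hsub]
  · refine sum_bij (fun j _ ↦ j * P.natDegree) ?_ ?_ ?_ ?_
    · intro j hj
      obtain ⟨hj, hjn⟩ := mem_filter.1 hj
      exact mem_filter.2 ⟨mem_Icc.2 ⟨Nat.mul_pos (mem_Icc.1 hj).1 hd, hjn⟩, dvd_mul_left _ _⟩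
    · intro i _ j _ h
      exact Nat.eq_of_mul_eq_mul_right hd h
    · intro m hm
      obtain ⟨hm, j, rfl⟩ := mem_filter.1 hm
      rw [mem_Icc] at hm
      refine ⟨j, mem_filter.2 ⟨mem_Icc.2 ⟨Nat.pos_of_mul_pos_left hm.1, ?_⟩, ?_⟩, mul_comm _ _⟩
      · exact (Nat.le_mul_of_pos_left _ hd).trans hm.2
      · rw [mul_comm]; exact hm.2
    · intro j hj
      rw [← sum_filter, ← mul_sum, sum_monics_filter_pow_dvd Λ h1 hmul hm j n (mem_filter.1 hj).2,
        Nat.mul_div_cancel _ hd, mul_assoc]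
  · intro j hj hj'
    refine sum_eq_zero fun f hf ↦ if_neg fun hdvd ↦ hj' (mem_filter.2 ⟨hj, ?_⟩)
    obtain ⟨hf', rfl⟩ := mem_monics.1 hf
    rw [← hm.natDegree_pow]
    exact natDegree_le_of_dvd hdvd hf'.ne_zero

/-- If the sums of a multiplicative function over monics of degree `≥ 2` vanish, the power sums
are determined by the sum in degree one. -/
theorem powerSum_eq {R : Type*} [CommRing R] (Λ : E[X] → R)
    (h1 : Λ 1 = 1) (hmul : ∀ f g : E[X], f.Monic → g.Monic → Λ (f * g) = Λ f * Λ g)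
    (hzero : ∀ n, 2 ≤ n → ∑ f ∈ monics E n, Λ f = 0) {k : ℕ} (hk : 1 ≤ k) :
    powerSum Λ k = (-1) ^ (k + 1) * (∑ f ∈ monics E 1, Λ f) ^ k := by
  have h0 : ∑ f ∈ monics E 0, Λ f = 1 := by
    have : monics E 0 = {1} := by
      ext f
      rw [mem_monics, mem_singleton]
      exact ⟨fun h ↦ h.1.natDegree_eq_zero.1 h.2, by rintro rfl; simp⟩
    rw [this, sum_singleton, h1]
  induction k, hk using Nat.le_induction with
  | base =>
    have := natCast_mul_sum_monics Λ h1 hmul 1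
    simpa [h0] using this.symm
  | succ k hk ih =>
    have := natCast_mul_sum_monics Λ h1 hmul (k + 1)
    rw [hzero _ (by omega), mul_zero, sum_Icc_succ_top (by omega), Nat.sub_self, h0, mul_one,
      sum_eq_single_of_mem k (by simp [hk]), ih, Nat.add_sub_cancel_left] at this
    · linear_combination -this
    · intro m hm hne
      rw [mem_Icc] at hm
      rw [hzero _ (by omega), mul_zero]

theorem card_filter_minpoly_eq {K : Type*} [Field K] [Fintype K] [DecidableEq K] [DecidableEq E[X]]
    [Algebra E K] {P : E[X]} (hm : P.Monic)
    (hi : Irreducible P) (hd : P.natDegree ∣ Module.finrank E K) :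
    #{x : K | minpoly E x = P} = P.natDegree := by
  have hcard : Nat.card E ^ Module.finrank E K = Fintype.card K := by
    rw [← Module.natCard_eq_pow_finrank, Nat.card_eq_fintype_card]
  have hsplit : (P.map (algebraMap E K)).Splits := by
    have hdvd := hi.natDegree_dvd_iff_dvd_X_pow_card_pow_sub_X.1 hd
    rw [hcard] at hdvd
    exact (FiniteField.isSplittingField_sub K E).splits.of_dvd
      (map_ne_zero (FiniteField.X_pow_card_sub_X_ne_zero _ Fintype.one_lt_card))
      (map_dvd (mapRingHom (algebraMap E K)) hdvd)
  have hsep : P.Separable := PerfectField.separable_of_irreducible hi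
  have hnd : (P.map (algebraMap E K)).roots.Nodup := nodup_roots hsep.map
  rw [← natDegree_map (algebraMap E K), hsplit.natDegree_eq_card_roots,
    ← Multiset.toFinset_card_of_nodup hnd]
  congr 1
  ext x
  rw [mem_filter_univ, Multiset.mem_toFinset, mem_roots (hm.map _).ne_zero, IsRoot.def,
    eval_map_algebraMap]
  constructor
  · rintro rfl
    exact minpoly.aeval E x
  · intro h
    exact (minpoly.eq_of_irreducible_of_monic hi h hm).symm

theorem sum_minpoly_pow_eq_powerSum {R : Type*} [CommRing R] (Λ : E[X] → R)
    (K : Type*) [Field K] [Fintype K] [Algebra E K] :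
    ∑ x : K, Λ (minpoly E x) ^ (Module.finrank E K / (minpoly E x).natDegree) =
      powerSum Λ (Module.finrank E K) := by
  classical
  have hmaps (x : K) : minpoly E x ∈
      ({P ∈ irreds E (Module.finrank E K) | P.natDegree ∣ Module.finrank E K} : Finset E[X]) := by
    have hx := Algebra.IsIntegral.isIntegral (R := E) x
    have hd := minpoly.degree_dvd hx
    exact mem_filter.2 ⟨mem_irreds.2 ⟨minpoly.monic hx, minpoly.irreducible hx,
      Nat.le_of_dvd Module.finrank_pos hd⟩, hd⟩
  rw [powerSum, ← sum_fiberwise_of_maps_to (fun x _ ↦ hmaps x)]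
  refine sum_congr rfl fun P hP ↦ ?_
  obtain ⟨hP, hd⟩ := mem_filter.1 hP
  obtain ⟨hm, hi, -⟩ := mem_irreds.1 hP
  rw [← card_filter_minpoly_eq (K := K) hm hi hd, ← nsmul_eq_mul]
  refine sum_eq_card_nsmul fun x hx ↦ ?_
  rw [(mem_filter.1 hx).2, card_filter_minpoly_eq (K := K) hm hi hd]

variable (χ : MulChar E ℂ) (ψ : AddChar E ℂ)

theorem sum_monics_one_polyChar [Fintype E] :
    ∑ f ∈ monics E 1, polyChar χ ψ f = gaussSum χ ψ := by
  rw [gaussSum]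
  symm
  refine sum_bij (fun a _ ↦ X - C a) ?_ ?_ ?_ ?_
  · intro a _
    exact mem_monics.2 ⟨monic_X_sub_C a, natDegree_X_sub_C a⟩
  · intro a _ b _ h
    exact C_injective (sub_right_injective h)
  · intro f hf
    obtain ⟨hf, hd⟩ := mem_monics.1 hf
    refine ⟨-f.coeff 0, mem_univ _, ?_⟩
    rw [map_neg, sub_neg_eq_add]
    exact (hf.eq_X_add_C hd).symm
  · intro a _
    simp [polyChar]

theorem sum_monics_polyChar_eq_zero (hψ : ψ ≠ 1) {n : ℕ} (hn : 2 ≤ n) :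
    ∑ f ∈ monics E n, polyChar χ ψ f = 0 := by
  obtain ⟨a, ha⟩ := (AddChar.ne_one_iff).1 hψ
  have hshift (b : E) {f : E[X]} (hf : f ∈ monics E n) :
      f - C b * X ^ (n - 1) ∈ monics E n := by
    obtain ⟨hm, rfl⟩ := mem_monics.1 hf
    have hdeg : (C b * X ^ (f.natDegree - 1)).degree < f.degree := by
      refine (degree_C_mul_X_pow_le _ _).trans_lt ?_
      rw [degree_eq_natDegree hm.ne_zero]
      exact_mod_cast (by omega)
    exact mem_monics.2 ⟨hm.sub_of_left hdeg,
      natDegree_eq_of_degree_eq (degree_sub_eq_left_of_degree_lt hdeg)⟩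
  have hval {f : E[X]} (hf : f ∈ monics E n) :
      polyChar χ ψ (f - C a * X ^ (n - 1)) = ψ a * polyChar χ ψ f := by
    have hd := (mem_monics.1 hf).2
    have hd' := (mem_monics.1 (hshift a hf)).2
    rw [polyChar, polyChar, hd', hd, nextCoeff_of_natDegree_pos (by omega), hd',
      nextCoeff_of_natDegree_pos (by omega), hd, coeff_sub, coeff_sub, coeff_C_mul_X_pow,
      coeff_C_mul_X_pow, if_neg (by omega), if_pos rfl, sub_zero, neg_sub, sub_eq_add_neg,
      AddChar.map_add_eq_mul]
    ring
  have hsum : ∑ f ∈ monics E n, polyChar χ ψ f = ψ a * ∑ f ∈ monics E n, polyChar χ ψ f := by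
    rw [mul_sum]
    symm
    refine sum_bij (fun f _ ↦ f - C a * X ^ (n - 1)) (fun f hf ↦ hshift a hf) ?_ ?_ ?_
    · intro f _ g _ h
      exact sub_left_injective h
    · intro f hf
      refine ⟨f - C (-a) * X ^ (n - 1), hshift _ hf, ?_⟩
      rw [map_neg]
      ring
    · intro f hf
      rw [hval hf]
  have : (1 - ψ a) * ∑ f ∈ monics E n, polyChar χ ψ f = 0 := by linear_combination hsum
  exact (mul_eq_zero.1 this).resolve_left (sub_ne_zero.2 (Ne.symm ha))

end HasseDavenport

/-- The Hasse–Davenport lifting relation for Gauss sums. -/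
theorem sum_norm_mul_trace_eq_gaussSum_pow {E K : Type*} [Field E] [Fintype E] [Field K]
    [Fintype K] [Algebra E K] (χ : MulChar E ℂ) {ψ : AddChar E ℂ} (hψ : ψ ≠ 1) :
    ∑ x : K, χ (Algebra.norm E x) * ψ (Algebra.trace E K x) =
      (-1) ^ (Module.finrank E K + 1) * gaussSum χ ψ ^ Module.finrank E K := by
  rw [← HasseDavenport.sum_monics_one_polyChar,
    ← HasseDavenport.powerSum_eq _ (HasseDavenport.polyChar_one χ ψ)
      (fun f g hf hg ↦ HasseDavenport.polyChar_mul χ ψ hf hg)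
      (fun n hn ↦ HasseDavenport.sum_monics_polyChar_eq_zero χ ψ hψ hn) Module.finrank_pos,
    ← HasseDavenport.sum_minpoly_pow_eq_powerSum]
  exact Finset.sum_congr rfl fun x _ ↦ (HasseDavenport.polyChar_minpoly χ ψ x).symm

/-- The pullback of a multiplicative character along a monoid homomorphism reflecting units. -/
def MulChar.pullback {R S R' : Type*} [CommMonoid R] [CommMonoid S] [CommMonoidWithZero R']
    (χ : MulChar S R') (f : R →* S) (hf : ∀ x, IsUnit (f x) → IsUnit x) : MulChar R R' where
  toMonoidHom := χ.toMonoidHom.comp f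
  map_nonunit' x hx := χ.map_nonunit fun h ↦ hx (hf x h)

theorem sum_units_eq_sum {K M : Type*} [Field K] [Fintype K] [DecidableEq K] [AddCommMonoid M]
    (f : K → M) (hf : f 0 = 0) : ∑ x : Kˣ, f x = ∑ x : K, f x := by
  rw [← Finset.sum_subset (Finset.subset_univ ((Finset.univ : Finset Kˣ).map
    ⟨Units.val, Units.val_injective⟩)), Finset.sum_map]
  · rfl
  · intro x _ hx
    rcases eq_or_ne x 0 with rfl | h
    · exact hf
    · exact absurd (Finset.mem_map.2 ⟨Units.mk0 x h, Finset.mem_univ _, rfl⟩) hx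

theorem gaussSum_mulShift_eq_of_ne_one {F : Type*} [Field F] [Fintype F] {χ : MulChar F ℂ}
    (hχ : χ ≠ 1) (ψ : AddChar F ℂ) (a : F) :
    gaussSum χ (ψ.mulShift a) = χ⁻¹ a * gaussSum χ ψ := by
  rcases eq_or_ne a 0 with rfl | ha
  · rw [AddChar.mulShift_zero, gaussSum_one_right hχ, MulChar.map_zero, zero_mul]
  · exact gaussSum_mulShift_eq χ ψ (Units.mk0 a ha)

/-- The Jacobi sum `∑ A(x) η(1 + x)` in terms of Gauss sums, for `η` nontrivial and even. -/
theorem card_mul_sum_mul_one_add_eq {F : Type*} [Field F] [Fintype F] (A : MulChar F ℂ)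
    {η : MulChar F ℂ} (hη : η ≠ 1) (hη1 : η (-1) = 1) {ψ : AddChar F ℂ} (hψ : ψ.IsPrimitive) :
    (Fintype.card F : ℂ) * ∑ x, A x * η (1 + x) =
      gaussSum (A * η)⁻¹ ψ * gaussSum A ψ * gaussSum η ψ := by
  have hη' : η⁻¹ ≠ 1 := inv_ne_one.2 hη
  have hcard : gaussSum η ψ * gaussSum η⁻¹ ψ = Fintype.card F := by
    rw [← gaussSum_mul_gaussSum_eq_card hη hψ, ← mul_gaussSum_inv_eq_gaussSum η⁻¹ ψ,
      MulChar.inv_apply', inv_neg_one, hη1, one_mul]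
  have key : (∑ x, A x * η (1 + x)) * gaussSum η⁻¹ ψ = gaussSum (A * η)⁻¹ ψ * gaussSum A ψ := by
    have h1 (x : F) : A x * η (1 + x) * gaussSum η⁻¹ ψ =
        ∑ y, η⁻¹ y * ψ y * (A x * ψ (y * x)) := by
      have := gaussSum_mulShift_eq_of_ne_one hη' ψ (1 + x)
      rw [inv_inv] at this
      rw [mul_assoc, ← this, gaussSum, Finset.mul_sum]
      refine Finset.sum_congr rfl fun y _ ↦ ?_
      rw [AddChar.mulShift_apply, add_mul, one_mul, AddChar.map_add_eq_mul, mul_comm x y]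
      ring
    rw [Finset.sum_mul, Finset.sum_congr rfl fun x _ ↦ h1 x, Finset.sum_comm, gaussSum,
      Finset.sum_mul]
    refine Finset.sum_congr rfl fun y _ ↦ ?_
    rw [← Finset.mul_sum]
    rcases eq_or_ne y 0 with rfl | hy
    · simp only [MulChar.map_zero, zero_mul]
    · have := gaussSum_mulShift_eq A ψ (Units.mk0 y hy)
      simp only [gaussSum, AddChar.mulShift_apply, Units.val_mk0] at this ⊢
      rw [this, mul_inv, MulChar.mul_apply]
      ring
  rw [← hcard]
  linear_combination gaussSum η ψ * key

/-- Let `E ⊆ K` be finite fields of odd characteristic with `[K:E] = k`,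
`σ_K` a ring automorphism of `K` mapping `E` onto itself with induced automorphism `σ_E`
(an involution compatible with norm and trace), `ψ` a nontrivial `σ_E`-invariant additive
character of `E`, `α` a multiplicative character of `K`, and `χ` a multiplicative
character of `E` such that `y ↦ χ(y σ_E(y))` is nontrivial on `Eˣ`. Then
`∑_{x ∈ Kˣ, x ≠ -1} α(x) χ(N(1+x)) χ(N(1 + σ_K(x)⁻¹))
  = (-1)^{k+1} |E|^{-k} (∑_x α(x)⁻¹ χ(N x)⁻¹ ψ_K(x)) (∑_x α(σ_K x) χ(N x)⁻¹ ψ_K(x))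
    (∑_{y ∈ Eˣ} χ(y σ_E(y)) ψ(y))^k`, where `ψ_K = ψ ∘ Tr_{K/E}`. -/
theorem split_torus_doubling_jacobi_sum
    (E K : Type*) [Field E] [Fintype E] [DecidableEq E]
    [Field K] [Fintype K] [DecidableEq K] [Algebra E K]
    (hE : ringChar E ≠ 2) (k : ℕ) (hdeg : Module.finrank E K = k)
    (σK : K ≃+* K) (σE : E ≃+* E)
    (hσ : ∀ x : E, σK (algebraMap E K x) = algebraMap E K (σE x))
    (hinv : ∀ y : E, σE (σE y) = y)
    (hnorm : ∀ x : K, Algebra.norm E (σK x) = σE (Algebra.norm E x))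
    (htrace : ∀ x : K, Algebra.trace E K (σK x) = σE (Algebra.trace E K x))
    (ψ : AddChar E ℂ) (hψ : ψ ≠ 1) (hψσ : ∀ y : E, ψ (σE y) = ψ y)
    (α : MulChar K ℂ) (χ : MulChar E ℂ)
    (hχ : ∃ y : Eˣ, χ ((y : E) * σE (y : E)) ≠ 1) :
    ∑ x ∈ Finset.univ.filter (fun x : Kˣ => (x : K) ≠ -1),
      α (x : K) * χ (Algebra.norm E (1 + (x : K))) *
        χ (Algebra.norm E (1 + (σK (x : K))⁻¹)) =
    (-1 : ℂ) ^ (k + 1) * (Fintype.card E : ℂ) ^ (-(k : ℤ)) *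
      (∑ x : Kˣ, (α (x : K))⁻¹ * (χ (Algebra.norm E (x : K)))⁻¹ *
        ψ (Algebra.trace E K (x : K))) *
      (∑ x : Kˣ, α (σK (x : K)) * (χ (Algebra.norm E (x : K)))⁻¹ *
        ψ (Algebra.trace E K (x : K))) *
      (∑ y : Eˣ, χ ((y : E) * σE (y : E)) * ψ (y : E)) ^ k := by
  classical
  subst hdeg
  have hNunit (x : K) (h : IsUnit (Algebra.norm E x)) : IsUnit x := by
    refine isUnit_iff_ne_zero.2 fun hx ↦ ?_
    rw [hx, Algebra.norm_zero] at h
    exact not_isUnit_zero h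
  set χ' : MulChar E ℂ := χ.pullback σE.toMonoidHom
    fun x h ↦ (MulEquiv.isUnit_map σE.toMulEquiv).1 h
  have hχ'_apply (y : E) : χ' y = χ (σE y) := rfl
  set ω : MulChar E ℂ := χ * χ' with hω
  have hω_apply (y : E) : ω y = χ (y * σE y) := by
    rw [hω, MulChar.mul_apply, hχ'_apply, map_mul]
  set χK : MulChar K ℂ := χ.pullback (Algebra.norm E) hNunit
  have hχK (x : K) : χK x = χ (Algebra.norm E x) := rfl
  set χK' : MulChar K ℂ := χ'.pullback (Algebra.norm E) hNunit
  have hχK' (x : K) : χK' x = χ (σE (Algebra.norm E x)) := rfl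
  set η : MulChar K ℂ := χK * χK' with hη
  have hη_apply (x : K) : η x = ω (Algebra.norm E x) := by
    rw [hη, hω, MulChar.mul_apply, MulChar.mul_apply]
    rfl
  set A : MulChar K ℂ := α * χK'⁻¹ with hA
  have hA_apply (x : K) : A x = α x * (χ (σE (Algebra.norm E x)))⁻¹ := by
    rw [hA, MulChar.mul_apply, MulChar.inv_apply_eq_inv', hχK']
  set Ψ : AddChar K ℂ := ψ.compAddMonoidHom (Algebra.trace E K).toAddMonoidHom with hΨ
  have hΨ_apply (x : K) : Ψ x = ψ (Algebra.trace E K x) := rfl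
  have hΨ_prim : Ψ.IsPrimitive := by
    refine AddChar.IsPrimitive.of_ne_one (AddChar.ne_one_iff.2 ?_)
    obtain ⟨a, ha⟩ := AddChar.ne_one_iff.1 hψ
    obtain ⟨x, rfl⟩ := Algebra.trace_surjective E K a
    exact ⟨x, ha⟩
  have hη_ne : η ≠ 1 := by
    obtain ⟨y, hy⟩ := hχ
    obtain ⟨x, hx⟩ := FiniteField.unitsMap_norm_surjective E K y
    refine MulChar.ne_one_iff.2 ⟨x, ?_⟩
    rw [hη_apply, hω_apply]
    have : Algebra.norm E (x : K) = y := congrArg Units.val hx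
    rwa [this]
  have hη_neg : η (-1) = 1 := by
    rw [hη_apply, hω_apply]
    have h : Algebra.norm E (-1 : K) = 1 ∨ Algebra.norm E (-1 : K) = -1 := by
      rw [← sq_eq_one_iff, ← map_pow, neg_one_sq, map_one]
    rcases h with h | h <;> simp [h]
  have hleft : ∑ x ∈ Finset.univ.filter (fun x : Kˣ => (x : K) ≠ -1),
      α (x : K) * χ (Algebra.norm E (1 + (x : K))) *
        χ (Algebra.norm E (1 + (σK (x : K))⁻¹)) = ∑ x, A x * η (1 + x) := by
    rw [Finset.sum_filter_of_ne,
      ← sum_units_eq_sum (fun x : K ↦ A x * η (1 + x)) (by simp only [MulChar.map_zero, zero_mul])]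
    · refine Finset.sum_congr rfl fun x _ ↦ ?_
      have hx : 1 + (σK (x : K))⁻¹ = σK ((1 + (x : K)) * (x : K)⁻¹) := by
        rw [map_mul, map_add, map_one, map_inv₀, add_mul, one_mul,
          mul_inv_cancel₀ ((map_ne_zero σK).2 x.ne_zero), add_comm]
      rw [hx, hnorm, map_mul, Algebra.norm_inv, map_mul, map_inv₀, map_mul, ← MulChar.inv_apply',
        MulChar.inv_apply_eq_inv', hA_apply, hη_apply, hω_apply, map_mul]
      ring
    · intro x _ h hx
      rw [hx, add_neg_cancel, Algebra.norm_zero, MulChar.map_zero, mul_zero, zero_mul] at h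
      exact h rfl
  have hfirst : ∑ x : Kˣ, (α (x : K))⁻¹ * (χ (Algebra.norm E (x : K)))⁻¹ *
      ψ (Algebra.trace E K (x : K)) = gaussSum (A * η)⁻¹ Ψ := by
    have h : A * η = α * χK := by
      rw [hA, hη, mul_comm χK, ← mul_assoc, inv_mul_cancel_right]
    rw [h, gaussSum,
      ← sum_units_eq_sum (fun x : K ↦ (α * χK)⁻¹ x * Ψ x) (by simp only [MulChar.map_zero, zero_mul])]
    refine Finset.sum_congr rfl fun x _ ↦ ?_
    rw [MulChar.inv_apply_eq_inv', MulChar.mul_apply, mul_inv, hχK, hΨ_apply]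
  have hsecond : ∑ x : Kˣ, α (σK (x : K)) * (χ (Algebra.norm E (x : K)))⁻¹ *
      ψ (Algebra.trace E K (x : K)) = gaussSum A Ψ := by
    rw [sum_units_eq_sum (fun x : K ↦ α (σK x) * (χ (Algebra.norm E x))⁻¹ *
      ψ (Algebra.trace E K x)) (by simp only [map_zero, MulChar.map_zero, zero_mul]), gaussSum]
    refine Fintype.sum_equiv σK.toEquiv _ _ fun x ↦ ?_
    change _ = A (σK x) * Ψ (σK x)
    rw [hA_apply, hΨ_apply, hnorm, htrace, hinv, hψσ]
  have hthird : ∑ y : Eˣ, χ ((y : E) * σE (y : E)) * ψ (y : E) = gaussSum ω ψ := by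
    rw [gaussSum,
      ← sum_units_eq_sum (fun y : E ↦ ω y * ψ y) (by simp only [MulChar.map_zero, zero_mul])]
    exact Finset.sum_congr rfl fun y _ ↦ by rw [hω_apply]
  have hHD : gaussSum η Ψ =
      (-1) ^ (Module.finrank E K + 1) * gaussSum ω ψ ^ Module.finrank E K := by
    rw [← sum_norm_mul_trace_eq_gaussSum_pow ω hψ, gaussSum]
    exact Finset.sum_congr rfl fun x _ ↦ by rw [hη_apply, hΨ_apply]
  have hmain := card_mul_sum_mul_one_add_eq A hη_ne hη_neg hΨ_prim
  rw [hHD, Module.card_eq_pow_finrank (K := E) (V := K), Nat.cast_pow] at hmain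
  have hq : (Fintype.card E : ℂ) ≠ 0 := Nat.cast_ne_zero.2 Fintype.card_ne_zero
  rw [hleft, hfirst, hsecond, hthird, zpow_neg, zpow_natCast]
  field_simp
  linear_combination hmain
end

section
/- Let E be a finite field of odd characteristic, k ≥ 1, ψ an additive character of E, and let π be a representation of GL_k(E) on a finite-dimensional complex vector space V. Let M be the subgroup of GL_k(E) consisting of all block matrices of the form (I_{k−1} X; 0 t) with X a column vector in E^{k−1} and t ∈ Eˣ (for k = 1, M = GL_1(E)). Assume that the only ℂ-linear map T : V → V satisfying T ∘ π(m) = T for every m ∈ M is T = 0. Then for every k×k matrix X₀ over E with det X₀ = 0, one has ∑_{g ∈ GL_k(E)} ψ(tr(X₀·g)) π(g) = 0 in the algebra of ℂ-linear endomorphisms of V. -/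
open scoped MatrixGroups

theorem Matrix.exists_isUnit_det_row_eq {K n : Type*} [Field K] [Fintype n] [DecidableEq n]
    (l : n) {w : n → K} (hw : w ≠ 0) : ∃ A : Matrix n n K, IsUnit A.det ∧ A l = w := by
  obtain ⟨i, hi⟩ := Function.ne_iff.mp hw
  refine ⟨((1 : Matrix n n K).updateRow i w).submatrix (Equiv.swap l i) id, ?_, ?_⟩
  · rw [Matrix.det_permute, ← Matrix.cramer_transpose_apply, Matrix.transpose_one,
      Matrix.cramer_one]
    exact ((Int.isUnit_iff.mpr (Int.units_eq_one_or _ |>.imp (congrArg Units.val)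
      (congrArg Units.val))).map (Int.castRingHom K)).mul (isUnit_iff_ne_zero.mpr hi)
  · ext j
    simp

theorem sum_addChar_trace_smul_comp {E R V n : Type*} [Field E] [Fintype E] [DecidableEq E]
    [Fintype n] [DecidableEq n] [CommSemiring R] [AddCommMonoid V] [Module R V]
    (ψ : AddChar E R) (π : Representation R (GL n E) V) {X : Matrix n n E} {a : GL n E}
    (ha : (a : Matrix n n E) * X = X) :
    (∑ g : GL n E, ψ ((X * (g : Matrix n n E)).trace) • π g) * π a =
      ∑ g : GL n E, ψ ((X * (g : Matrix n n E)).trace) • π g := by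
  rw [Finset.sum_mul, ← Equiv.sum_comp (Equiv.mulRight a)
    (fun g : GL n E => ψ ((X * (g : Matrix n n E)).trace) • π g)]
  refine Finset.sum_congr rfl fun g _ => ?_
  have h : (X * ((g * a : GL n E) : Matrix n n E)).trace = (X * (g : Matrix n n E)).trace := by
    rw [Units.val_mul, ← mul_assoc, Matrix.trace_mul_comm, ← mul_assoc, ha]
  simp only [Equiv.coe_mulRight, h, map_mul, smul_mul_assoc]

/-- Let `E` be a finite field of odd characteristic, `k ≥ 1`, `ψ` an
additive character of `E`, and `π` a representation of `GL_k(E)` on a finite-dimensional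
complex vector space `V`. Let `M` be the (mirabolic-transpose) subgroup of matrices of
the block form `(I_{k-1} X; 0 t)`, i.e. all invertible matrices whose first `k - 1`
columns are the corresponding standard basis columns. If the only linear map
`T : V → V` with `T ∘ π(m) = T` for all `m ∈ M` is `T = 0`, then for every singular
`k × k` matrix `X₀` over `E` one has `∑_{g ∈ GL_k(E)} ψ(tr(X₀ g)) π(g) = 0`. -/
theorem gauss_sum_operator_singular_vanishes
    (E : Type*) [Field E] [Fintype E] [DecidableEq E] (hE : ringChar E ≠ 2)
    (k : ℕ) (hk : 1 ≤ k)
    (ψ : AddChar E ℂ)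
    (V : Type*) [AddCommGroup V] [Module ℂ V] [FiniteDimensional ℂ V]
    (π : Representation ℂ (GL (Fin k) E) V)
    (hM : ∀ T : V →ₗ[ℂ] V,
      (∀ g : GL (Fin k) E,
        (∀ i j : Fin k, (j : ℕ) < k - 1 →
          (g : Matrix (Fin k) (Fin k) E) i j = if i = j then 1 else 0) →
        T ∘ₗ π g = T) → T = 0)
    (X₀ : Matrix (Fin k) (Fin k) E) (hX₀ : X₀.det = 0) :
    ∑ g : GL (Fin k) E,
      ψ ((X₀ * (g : Matrix (Fin k) (Fin k) E)).trace) • π g = 0 := by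
  obtain ⟨w, hw, hwX⟩ := Matrix.exists_vecMul_eq_zero_iff.mpr hX₀
  let l : Fin k := ⟨k - 1, by omega⟩
  obtain ⟨A, hA, hAw⟩ := Matrix.exists_isUnit_det_row_eq l hw
  let a : GL (Fin k) E := Matrix.nonsingInvUnit A hA
  have hrow : ∀ j, (A * X₀) l j = 0 := fun j => by
    rw [Matrix.mul_apply_eq_vecMul, hAw, hwX, Pi.zero_apply]
  set S := ∑ g : GL (Fin k) E, ψ ((X₀ * (g : Matrix (Fin k) (Fin k) E)).trace) • π g
  have hzero : S * π a⁻¹ = 0 := by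
    refine hM _ fun m hm => ?_
    have hmY : (m : Matrix (Fin k) (Fin k) E) * (A * X₀) = A * X₀ := by
      ext i j
      rw [Matrix.mul_apply, Finset.sum_eq_single i]
      · by_cases hi : (i : ℕ) < k - 1
        · rw [hm i i hi, if_pos rfl, one_mul]
        · have : i = l := Fin.ext (by have := i.isLt; simp only [l]; omega)
          rw [this, hrow, mul_zero]
      · intro b _ hb
        by_cases hbk : (b : ℕ) < k - 1
        · rw [hm i b hbk, if_neg hb.symm, zero_mul]
        · have : b = l := Fin.ext (by have := b.isLt; simp only [l]; omega)
          rw [this, hrow, mul_zero]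
      · simp
    have hconj : ((a⁻¹ * m * a : GL (Fin k) E) : Matrix (Fin k) (Fin k) E) * X₀ = X₀ := by
      rw [Units.val_mul, Units.val_mul, mul_assoc, mul_assoc]
      change _ * ((m : Matrix (Fin k) (Fin k) E) * (A * X₀)) = X₀
      rw [hmY]
      exact Units.inv_mul_cancel_left a X₀
    have h := congrArg (· * π a⁻¹) (sum_addChar_trace_smul_comp ψ π hconj)
    simp only [mul_assoc, ← map_mul, mul_inv_cancel, mul_one] at h
    change S * π a⁻¹ * π m = S * π a⁻¹
    rw [mul_assoc, ← map_mul]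
    exact h
  calc S = S * π a⁻¹ * π a := by rw [mul_assoc, ← map_mul, inv_mul_cancel, map_one, mul_one]
    _ = 0 := by rw [hzero, zero_mul]
end
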